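/- The sequent calculus G4WK has the uniform interpolation property: for every sequent Γ ⇒ Δ (with |Δ| ≤ 1) and every propositional variable p there exist formulas E_p(Γ) and A_p(Γ ⇒ Δ) such that (1) vars(E_p(Γ)) ⊆ vars(Γ)\{p} and vars(A_p(Γ ⇒ Δ)) ⊆ vars(Γ,Δ)\{p}; (2) ⊢_G4WK Γ ⇒ E_p(Γ) and ⊢_G4WK Γ, A_p(Γ ⇒ Δ) ⇒ Δ; and (3) for every finite multiset Π with p ∉ vars(Π), if ⊢_G4WK Π, Γ ⇒ Δ then ⊢_G4WK Π, E_p(Γ) ⇒ Δ whenever p ∉ vars(Δ), and ⊢_G4WK Π, E_p(Γ) ⇒ A_p(Γ ⇒ Δ). -/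

import Mathlib

/-- Formulas of the modal language: φ ::= p | ⊥ | φ∧φ | φ∨φ | φ→φ | □φ | ◇φ. -/
inductive Form : Type
  | var : ℕ → Form
  | bot : Form
  | and : Form → Form → Form
  | or  : Form → Form → Form
  | imp : Form → Form → Form
  | box : Form → Form
  | dia : Form → Form
  deriving DecidableEq

/-- Helper for □⁻¹: remove an outer box. -/
def unboxF : Form → Option Form
  | Form.box φ => some φ
  | _ => none

/-- □⁻¹Γ := {φ | □φ ∈ Γ}, as a multiset operation. -/
def boxInv (Γ : Multiset Form) : Multiset Form := Γ.filterMap unboxF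

/-- ◇⁻¹Δ for a succedent Δ with at most one formula (modelled by `Option`). -/
def diaInv : Option Form → Option Form
  | some (Form.dia φ) => some φ
  | _ => none

/-- Provability in the sequent calculus G4CK: sequents Γ ⇒ δ with a
multiset antecedent and a single-formula succedent. -/
inductive G4CK : Multiset Form → Form → Prop
  | botL (Γ δ) : G4CK (Form.bot ::ₘ Γ) δ
  | idP (Γ n) : G4CK (Form.var n ::ₘ Γ) (Form.var n)
  | andL (Γ φ ψ δ) : G4CK (φ ::ₘ ψ ::ₘ Γ) δ → G4CK (Form.and φ ψ ::ₘ Γ) δ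
  | andR (Γ φ ψ) : G4CK Γ φ → G4CK Γ ψ → G4CK Γ (Form.and φ ψ)
  | orL (Γ φ ψ δ) : G4CK (φ ::ₘ Γ) δ → G4CK (ψ ::ₘ Γ) δ → G4CK (Form.or φ ψ ::ₘ Γ) δ
  | orR1 (Γ φ ψ) : G4CK Γ φ → G4CK Γ (Form.or φ ψ)
  | orR2 (Γ φ ψ) : G4CK Γ ψ → G4CK Γ (Form.or φ ψ)
  | impR (Γ φ ψ) : G4CK (φ ::ₘ Γ) ψ → G4CK Γ (Form.imp φ ψ)
  | andImpL (Γ φ ψ χ δ) :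
      G4CK (Form.imp φ (Form.imp ψ χ) ::ₘ Γ) δ →
      G4CK (Form.imp (Form.and φ ψ) χ ::ₘ Γ) δ
  | orImpL (Γ φ ψ χ δ) :
      G4CK (Form.imp φ χ ::ₘ Form.imp ψ χ ::ₘ Γ) δ →
      G4CK (Form.imp (Form.or φ ψ) χ ::ₘ Γ) δ
  | pImpL (Γ n φ δ) :
      G4CK (Form.var n ::ₘ φ ::ₘ Γ) δ →
      G4CK (Form.var n ::ₘ Form.imp (Form.var n) φ ::ₘ Γ) δ
  | impImpL (Γ φ ψ χ δ) :
      G4CK (Form.imp ψ χ ::ₘ Γ) (Form.imp φ ψ) → G4CK (χ ::ₘ Γ) δ →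
      G4CK (Form.imp (Form.imp φ ψ) χ ::ₘ Γ) δ
  | boxR (Γ φ) : G4CK (boxInv Γ) φ → G4CK Γ (Form.box φ)
  | boxImpL (Γ φ ψ δ) :
      G4CK (boxInv Γ) φ → G4CK (ψ ::ₘ Γ) δ →
      G4CK (Form.imp (Form.box φ) ψ ::ₘ Γ) δ
  | diaImpL (Γ γ φ ψ δ) :
      G4CK (γ ::ₘ boxInv Γ) φ → G4CK (ψ ::ₘ Form.dia γ ::ₘ Γ) δ →
      G4CK (Form.imp (Form.dia φ) ψ ::ₘ Form.dia γ ::ₘ Γ) δ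
  | diaL (Γ φ ψ) : G4CK (φ ::ₘ boxInv Γ) ψ → G4CK (Form.dia φ ::ₘ Γ) (Form.dia ψ)

/-- Provability in the sequent calculus G4WK: sequents Γ ⇒ Δ with a
multiset antecedent and a succedent with at most one formula (`Option Form`). -/
inductive G4WK : Multiset Form → Option Form → Prop
  | botL (Γ Δ) : G4WK (Form.bot ::ₘ Γ) Δ
  | idP (Γ n) : G4WK (Form.var n ::ₘ Γ) (some (Form.var n))
  | andL (Γ φ ψ Δ) : G4WK (φ ::ₘ ψ ::ₘ Γ) Δ → G4WK (Form.and φ ψ ::ₘ Γ) Δ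
  | andR (Γ φ ψ) : G4WK Γ (some φ) → G4WK Γ (some ψ) → G4WK Γ (some (Form.and φ ψ))
  | orL (Γ φ ψ Δ) : G4WK (φ ::ₘ Γ) Δ → G4WK (ψ ::ₘ Γ) Δ → G4WK (Form.or φ ψ ::ₘ Γ) Δ
  | orR1 (Γ φ ψ) : G4WK Γ (some φ) → G4WK Γ (some (Form.or φ ψ))
  | orR2 (Γ φ ψ) : G4WK Γ (some ψ) → G4WK Γ (some (Form.or φ ψ))
  | impR (Γ φ ψ) : G4WK (φ ::ₘ Γ) (some ψ) → G4WK Γ (some (Form.imp φ ψ))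
  | andImpL (Γ φ ψ χ Δ) :
      G4WK (Form.imp φ (Form.imp ψ χ) ::ₘ Γ) Δ →
      G4WK (Form.imp (Form.and φ ψ) χ ::ₘ Γ) Δ
  | orImpL (Γ φ ψ χ Δ) :
      G4WK (Form.imp φ χ ::ₘ Form.imp ψ χ ::ₘ Γ) Δ →
      G4WK (Form.imp (Form.or φ ψ) χ ::ₘ Γ) Δ
  | pImpL (Γ n φ Δ) :
      G4WK (Form.var n ::ₘ φ ::ₘ Γ) Δ →
      G4WK (Form.var n ::ₘ Form.imp (Form.var n) φ ::ₘ Γ) Δ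
  | impImpL (Γ φ ψ χ Δ) :
      G4WK (Form.imp ψ χ ::ₘ Γ) (some (Form.imp φ ψ)) → G4WK (χ ::ₘ Γ) Δ →
      G4WK (Form.imp (Form.imp φ ψ) χ ::ₘ Γ) Δ
  | boxR (Γ φ) : G4WK (boxInv Γ) (some φ) → G4WK Γ (some (Form.box φ))
  | boxImpL (Γ φ ψ Δ) :
      G4WK (boxInv Γ) (some φ) → G4WK (ψ ::ₘ Γ) Δ →
      G4WK (Form.imp (Form.box φ) ψ ::ₘ Γ) Δ
  | diaImpL (Γ γ φ ψ Δ) :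
      G4WK (γ ::ₘ boxInv Γ) (some φ) → G4WK (ψ ::ₘ Form.dia γ ::ₘ Γ) Δ →
      G4WK (Form.imp (Form.dia φ) ψ ::ₘ Form.dia γ ::ₘ Γ) Δ
  | diaL' (Γ φ Δ) : G4WK (φ ::ₘ boxInv Γ) (diaInv Δ) → G4WK (Form.dia φ ::ₘ Γ) Δ

/-- Axiom schemes of the generalised Hilbert calculus CKH:
intuitionistic axioms A1–A9 together with K_□ and K_◇. -/
inductive CKAx : Form → Prop
  | a1 (φ ψ : Form) : CKAx (φ.imp (ψ.imp φ))
  | a2 (φ ψ χ : Form) : CKAx ((φ.imp (ψ.imp χ)).imp ((φ.imp ψ).imp (φ.imp χ)))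
  | a3 (φ ψ : Form) : CKAx (φ.imp (φ.or ψ))
  | a4 (φ ψ : Form) : CKAx (ψ.imp (φ.or ψ))
  | a5 (φ ψ χ : Form) : CKAx ((φ.imp χ).imp ((ψ.imp χ).imp ((φ.or ψ).imp χ)))
  | a6 (φ ψ : Form) : CKAx ((φ.and ψ).imp φ)
  | a7 (φ ψ : Form) : CKAx ((φ.and ψ).imp ψ)
  | a8 (φ ψ χ : Form) : CKAx ((φ.imp ψ).imp ((φ.imp χ).imp (φ.imp (ψ.and χ))))
  | a9 (φ : Form) : CKAx (Form.bot.imp φ)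
  | kbox (φ ψ : Form) : CKAx ((φ.imp ψ).box.imp (φ.box.imp ψ.box))
  | kdia (φ ψ : Form) : CKAx ((φ.imp ψ).box.imp (φ.dia.imp ψ.dia))

/-- Axiom schemes of WKH: those of CKH together with N : ¬◇⊥. -/
inductive WKAx : Form → Prop
  | ck {φ : Form} : CKAx φ → WKAx φ
  | n : WKAx (Form.bot.dia.imp Form.bot)

/-- Derivability Γ ⊢ φ in the generalised Hilbert calculus CKH. -/
inductive CKH : Set Form → Form → Prop
  | ax {Γ : Set Form} {φ : Form} : CKAx φ → CKH Γ φ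
  | el {Γ : Set Form} {φ : Form} : φ ∈ Γ → CKH Γ φ
  | mp {Γ : Set Form} {φ ψ : Form} : CKH Γ φ → CKH Γ (φ.imp ψ) → CKH Γ ψ
  | nec {Γ : Set Form} {φ : Form} : CKH ∅ φ → CKH Γ φ.box

/-- Derivability Γ ⊢ φ in the generalised Hilbert calculus WKH. -/
inductive WKH : Set Form → Form → Prop
  | ax {Γ : Set Form} {φ : Form} : WKAx φ → WKH Γ φ
  | el {Γ : Set Form} {φ : Form} : φ ∈ Γ → WKH Γ φ
  | mp {Γ : Set Form} {φ ψ : Form} : WKH Γ φ → WKH Γ (φ.imp ψ) → WKH Γ ψ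
  | nec {Γ : Set Form} {φ : Form} : WKH ∅ φ → WKH Γ φ.box

/-- The set of propositional variables occurring in a formula. -/
def vars : Form → Set ℕ
  | .var n => {n}
  | .bot => ∅
  | .and φ ψ => vars φ ∪ vars ψ
  | .or φ ψ => vars φ ∪ vars ψ
  | .imp φ ψ => vars φ ∪ vars ψ
  | .box φ => vars φ
  | .dia φ => vars φ

/-- Variables occurring in a multiset of formulas. -/
def varsM (Γ : Multiset Form) : Set ℕ := {n | ∃ φ ∈ Γ, n ∈ vars φ}

/-- Variables occurring in a succedent with at most one formula. -/
def varsO : Option Form → Set ℕ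
  | none => ∅
  | some φ => vars φ

/-! ### Sequents: sizes, boxes and variables -/

/-- The weight of a formula, along which every rule of G4WK decreases. -/
def Form.weight : Form → ℕ
  | .var _ => 1
  | .bot => 1
  | .and φ ψ => φ.weight + ψ.weight + 2
  | .or φ ψ => φ.weight + ψ.weight + 1
  | .imp φ ψ => φ.weight + ψ.weight + 1
  | .box φ => φ.weight + 1
  | .dia φ => φ.weight + 1

/-- The exponential of the weight: one formula outranks any two lighter ones together. -/
def Form.rank (φ : Form) : ℕ := 3 ^ φ.weight

/-- The total rank of an antecedent. -/
def rankM (Γ : Multiset Form) : ℕ := (Γ.map Form.rank).sum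

/-- The rank of a succedent. -/
def rankO : Option Form → ℕ
  | none => 0
  | some φ => φ.rank

theorem Form.rank_pos (φ : Form) : 0 < φ.rank := by
  simp [Form.rank]

theorem Form.rank_add_lt {φ ψ χ : Form} (h₁ : φ.weight < χ.weight) (h₂ : ψ.weight < χ.weight) :
    φ.rank + ψ.rank < χ.rank := by
  obtain ⟨k, hk⟩ : ∃ k, χ.weight = k + 1 := ⟨χ.weight - 1, by omega⟩
  have a : 3 ^ φ.weight ≤ 3 ^ k := Nat.pow_le_pow_right (by norm_num) (by omega)
  have b : 3 ^ ψ.weight ≤ 3 ^ k := Nat.pow_le_pow_right (by norm_num) (by omega)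
  have c : 0 < 3 ^ k := by positivity
  simp only [Form.rank, hk, pow_succ]
  omega

theorem Form.rank_lt {φ χ : Form} (h : φ.weight < χ.weight) : φ.rank < χ.rank :=
  Nat.pow_lt_pow_right (by norm_num) h

theorem Form.rank_and (φ ψ : Form) : φ.rank + ψ.rank < (φ.and ψ).rank :=
  rank_add_lt (by simp +arith [weight]) (by simp +arith [weight])

theorem Form.rank_or (φ ψ : Form) : φ.rank + ψ.rank < (φ.or ψ).rank :=
  rank_add_lt (by simp +arith [weight]) (by simp +arith [weight])

theorem Form.rank_imp (φ ψ : Form) : φ.rank + ψ.rank < (φ.imp ψ).rank :=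
  rank_add_lt (by simp +arith [weight]) (by simp +arith [weight])

theorem Form.rank_box (φ : Form) : φ.rank < φ.box.rank := rank_lt (by simp [weight])

theorem Form.rank_dia (φ : Form) : φ.rank < φ.dia.rank := rank_lt (by simp [weight])

theorem Form.rank_and_imp (φ ψ χ : Form) :
    (φ.imp (ψ.imp χ)).rank < ((φ.and ψ).imp χ).rank :=
  rank_lt (by simp +arith [weight])

theorem Form.rank_or_imp (φ ψ χ : Form) :
    (φ.imp χ).rank + (ψ.imp χ).rank < ((φ.or ψ).imp χ).rank :=
  rank_add_lt (by simp +arith [weight]) (by simp +arith [weight])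

theorem Form.rank_imp_imp (φ ψ χ : Form) :
    (ψ.imp χ).rank + (φ.imp ψ).rank < ((φ.imp ψ).imp χ).rank :=
  rank_add_lt (by simp +arith [weight]) (by simp +arith [weight])

@[simp] theorem rankM_cons (φ : Form) (Γ : Multiset Form) :
    rankM (φ ::ₘ Γ) = φ.rank + rankM Γ := by simp [rankM]

@[simp] theorem rankO_none : rankO none = 0 := rfl

@[simp] theorem rankO_some (φ : Form) : rankO (some φ) = φ.rank := rfl

theorem rankM_erase {φ : Form} {Γ : Multiset Form} (h : φ ∈ Γ) :
    φ.rank + rankM (Γ.erase φ) = rankM Γ := by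
  rw [← rankM_cons, Multiset.cons_erase h]

@[simp] theorem mem_boxInv {φ : Form} {Γ : Multiset Form} :
    φ ∈ boxInv Γ ↔ Form.box φ ∈ Γ := by
  simp only [boxInv, Multiset.mem_filterMap]
  constructor
  · rintro ⟨ψ, h, e⟩
    cases ψ <;> simp_all [unboxF]
  · exact fun h => ⟨_, h, rfl⟩

@[simp] theorem boxInv_add (Γ Γ' : Multiset Form) :
    boxInv (Γ + Γ') = boxInv Γ + boxInv Γ' := by
  simp [boxInv, Multiset.filterMap_add]

theorem boxInv_cons_box (φ : Form) (Γ : Multiset Form) :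
    boxInv (Form.box φ ::ₘ Γ) = φ ::ₘ boxInv Γ :=
  Multiset.filterMap_cons_some _ _ _ rfl

theorem boxInv_cons_of_none {φ : Form} (h : unboxF φ = none) (Γ : Multiset Form) :
    boxInv (φ ::ₘ Γ) = boxInv Γ :=
  Multiset.filterMap_cons_none _ _ h

@[simp] theorem boxInv_cons_dia (φ : Form) (Γ : Multiset Form) :
    boxInv (Form.dia φ ::ₘ Γ) = boxInv Γ := boxInv_cons_of_none rfl Γ

@[simp] theorem boxInv_cons_imp (φ ψ : Form) (Γ : Multiset Form) :
    boxInv (Form.imp φ ψ ::ₘ Γ) = boxInv Γ := boxInv_cons_of_none rfl Γ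

theorem boxInv_erase_dia {φ : Form} {Γ : Multiset Form} (h : Form.dia φ ∈ Γ) :
    boxInv (Γ.erase (Form.dia φ)) = boxInv Γ := by
  rw [← boxInv_cons_dia φ, Multiset.cons_erase h]

theorem boxInv_erase_imp {φ ψ : Form} {Γ : Multiset Form} (h : Form.imp φ ψ ∈ Γ) :
    boxInv (Γ.erase (Form.imp φ ψ)) = boxInv Γ := by
  rw [← boxInv_cons_imp φ ψ, Multiset.cons_erase h]

theorem rankM_boxInv_cons_lt (φ : Form) (Γ : Multiset Form) :
    rankM (boxInv (φ ::ₘ Γ)) < φ.rank + rankM (boxInv Γ) := by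
  have hpos := φ.rank_pos
  cases φ with
  | box ψ =>
    have := ψ.rank_box
    rw [boxInv_cons_box, rankM_cons]
    omega
  | _ =>
    rw [boxInv_cons_of_none rfl]
    omega

theorem rankM_boxInv_le (Γ : Multiset Form) : rankM (boxInv Γ) ≤ rankM Γ := by
  induction Γ using Multiset.induction with
  | empty => simp [boxInv]
  | cons φ Γ ih =>
    have := rankM_boxInv_cons_lt φ Γ
    rw [rankM_cons]
    omega

theorem rankM_boxInv_lt {φ : Form} {Γ : Multiset Form} (h : φ ∈ Γ) :
    rankM (boxInv Γ) < rankM Γ := by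
  have h₁ := rankM_boxInv_cons_lt φ (Γ.erase φ)
  have h₂ := rankM_boxInv_le (Γ.erase φ)
  rw [Multiset.cons_erase h] at h₁
  rw [← rankM_erase h]
  omega

/-! ### Kripke semantics -/

/-- Birelational Kripke models without fallible worlds. -/
structure KModel where
  /-- worlds -/
  W : Type
  /-- intuitionistic preorder -/
  le : W → W → Prop
  /-- modal accessibility relation -/
  R : W → W → Prop
  /-- valuation -/
  V : W → ℕ → Prop
  le_refl : ∀ w, le w w
  le_trans : ∀ {u v w}, le u v → le v w → le u w
  V_mono : ∀ {v w n}, le v w → V v n → V w n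

namespace KModel

/-- The forcing relation. -/
def Forces (M : KModel) : M.W → Form → Prop
  | w, .var n => M.V w n
  | _, .bot => False
  | w, .and φ ψ => Forces M w φ ∧ Forces M w ψ
  | w, .or φ ψ => Forces M w φ ∨ Forces M w ψ
  | w, .imp φ ψ => ∀ v, M.le w v → Forces M v φ → Forces M v ψ
  | w, .box φ => ∀ v, M.le w v → ∀ u, M.R v u → Forces M u φ
  | w, .dia φ => ∀ v, M.le w v → ∃ u, M.R v u ∧ Forces M u φ

/-- Forcing of every formula of an antecedent. -/
def ForcesAll (M : KModel) (w : M.W) (Γ : Multiset Form) : Prop := ∀ φ ∈ Γ, M.Forces w φ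

/-- Forcing of a succedent. -/
def ForcesOpt (M : KModel) (w : M.W) : Option Form → Prop
  | none => False
  | some φ => M.Forces w φ

variable {M : KModel} {w v u : M.W} {φ ψ : Form} {Γ Γ' : Multiset Form} {Δ : Option Form}

theorem Forces.mono : ∀ {φ : Form} {w v : M.W}, M.le w v → M.Forces w φ → M.Forces v φ
  | .var _, _, _, h, hf => M.V_mono h hf
  | .and _ _, _, _, h, hf => ⟨Forces.mono h hf.1, Forces.mono h hf.2⟩
  | .or _ _, _, _, h, hf => hf.imp (Forces.mono h) (Forces.mono h)
  | .imp _ _, _, _, h, hf => fun v' hv => hf v' (M.le_trans h hv)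
  | .box _, _, _, h, hf => fun v' hv => hf v' (M.le_trans h hv)
  | .dia _, _, _, h, hf => fun v' hv => hf v' (M.le_trans h hv)

theorem ForcesAll.mono (h : M.le w v) (hf : M.ForcesAll w Γ) : M.ForcesAll v Γ :=
  fun φ hφ => (hf φ hφ).mono h

theorem Forces.mp (h : M.Forces w (φ.imp ψ)) (hφ : M.Forces w φ) : M.Forces w ψ :=
  h w (M.le_refl w) hφ

@[simp] theorem forcesAll_cons :
    M.ForcesAll w (φ ::ₘ Γ) ↔ M.Forces w φ ∧ M.ForcesAll w Γ := by simp [ForcesAll]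

@[simp] theorem forcesOpt_none : M.ForcesOpt w none ↔ False := Iff.rfl

theorem ForcesAll.boxInv (h : M.R w u) (hf : M.ForcesAll w Γ) : M.ForcesAll u (boxInv Γ) :=
  fun _ hφ => hf _ (mem_boxInv.1 hφ) w (M.le_refl w) u h

theorem forcesAll_of_erase (hm : φ ∈ Γ) (h : M.Forces w φ) (hf : M.ForcesAll w (Γ.erase φ)) :
    M.ForcesAll w Γ := by
  rw [← Multiset.cons_erase hm]
  exact forcesAll_cons.2 ⟨h, hf⟩

end KModel

open KModel

/-- Validity of a sequent in all Kripke models. -/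
def Valid (Γ : Multiset Form) (Δ : Option Form) : Prop :=
  ∀ (M : KModel) (w : M.W), M.ForcesAll w Γ → M.ForcesOpt w Δ

theorem KModel.dia_of_diaInv {M : KModel} {w : M.W} {φ : Form} {Δ : Option Form}
    (hφ : M.Forces w (Form.dia φ))
    (h : ∀ v, M.le w v → ∀ u, M.R v u → M.Forces u φ → M.ForcesOpt u (diaInv Δ)) :
    M.ForcesOpt w Δ := by
  obtain ⟨u, hu, hf⟩ := hφ w (M.le_refl w)
  have := h w (M.le_refl w) u hu hf
  unfold diaInv at h this
  split at h
  · intro v hv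
    obtain ⟨u, hu, hf⟩ := hφ v hv
    exact ⟨u, hu, h v hv u hu hf⟩
  · simp at this

theorem G4WK.sound {Γ : Multiset Form} {Δ : Option Form} (h : G4WK Γ Δ) : Valid Γ Δ := by
  induction h with
  | botL => exact fun M w h => ((forcesAll_cons.1 h).1).elim
  | idP => exact fun M w h => (forcesAll_cons.1 h).1
  | andL Γ φ ψ Δ _ ih =>
    intro M w h
    apply ih M w
    simp only [forcesAll_cons, Forces] at h ⊢
    tauto
  | andR Γ φ ψ _ _ ih₁ ih₂ => exact fun M w h => ⟨ih₁ M w h, ih₂ M w h⟩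
  | orL Γ φ ψ Δ _ _ ih₁ ih₂ =>
    intro M w h
    have h₁ := ih₁ M w
    have h₂ := ih₂ M w
    simp only [forcesAll_cons, Forces] at h h₁ h₂
    tauto
  | orR1 Γ φ ψ _ ih => exact fun M w h => Or.inl (ih M w h)
  | orR2 Γ φ ψ _ ih => exact fun M w h => Or.inr (ih M w h)
  | impR Γ φ ψ _ ih =>
    exact fun M w h v hv hφ => ih M v (forcesAll_cons.2 ⟨hφ, h.mono hv⟩)
  | andImpL Γ φ ψ χ Δ _ ih =>
    intro M w h
    rw [forcesAll_cons] at h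
    refine ih M w (forcesAll_cons.2 ⟨fun v hv hφ v' hv' hψ => ?_, h.2⟩)
    exact h.1 v' (M.le_trans hv hv') ⟨hφ.mono hv', hψ⟩
  | orImpL Γ φ ψ χ Δ _ ih =>
    intro M w h
    rw [forcesAll_cons] at h
    refine ih M w ?_
    simp only [forcesAll_cons]
    exact ⟨fun v hv hφ => h.1 v hv (Or.inl hφ), fun v hv hφ => h.1 v hv (Or.inr hφ), h.2⟩
  | pImpL Γ n φ Δ _ ih =>
    intro M w h
    refine ih M w ?_
    simp only [forcesAll_cons] at h ⊢
    exact ⟨h.1, h.2.1.mp h.1, h.2.2⟩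
  | impImpL Γ φ ψ χ Δ _ _ ih₁ ih₂ =>
    intro M w h
    rw [forcesAll_cons] at h
    refine ih₂ M w (forcesAll_cons.2 ⟨h.1.mp (ih₁ M w (forcesAll_cons.2 ⟨?_, h.2⟩)), h.2⟩)
    exact fun v hv hψ => h.1 v hv fun v' hv' _ => hψ.mono hv'
  | boxR Γ φ _ ih =>
    exact fun M w h v hv u hu => ih M u ((h.mono hv).boxInv hu)
  | boxImpL Γ φ ψ Δ _ _ ih₁ ih₂ =>
    intro M w h
    rw [forcesAll_cons] at h
    refine ih₂ M w (forcesAll_cons.2 ⟨h.1.mp ?_, h.2⟩)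
    exact fun v hv u hu => ih₁ M u ((h.2.mono hv).boxInv hu)
  | diaImpL Γ γ φ ψ Δ _ _ ih₁ ih₂ =>
    intro M w h
    simp only [forcesAll_cons] at h
    refine ih₂ M w (forcesAll_cons.2 ⟨h.1.mp ?_, forcesAll_cons.2 h.2⟩)
    intro v hv
    obtain ⟨u, hu, hf⟩ := h.2.1 v hv
    exact ⟨u, hu, ih₁ M u (forcesAll_cons.2 ⟨hf, (h.2.2.mono hv).boxInv hu⟩)⟩
  | diaL' Γ φ Δ _ ih =>
    intro M w h
    rw [forcesAll_cons] at h
    refine dia_of_diaInv h.1 fun v hv u hu hf => ih M u ?_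
    exact forcesAll_cons.2 ⟨hf, (h.2.mono hv).boxInv hu⟩
/-! ### Completeness -/

section Glue

variable {I C : Type} (M : I → KModel) (r : ∀ i, (M i).W) (U : Set I) (S : C → Set I)

/-- Intuitionistic order of the gluing: a cluster `C` below the points `r i` with `i ∈ U`. -/
inductive GlueLe : (Σ i, (M i).W) ⊕ C → (Σ i, (M i).W) ⊕ C → Prop
  | old {i : I} {w v : (M i).W} : (M i).le w v → GlueLe (.inl ⟨i, w⟩) (.inl ⟨i, v⟩)
  | up {c : C} {i : I} {w : (M i).W} : i ∈ U → (M i).le (r i) w → GlueLe (.inr c) (.inl ⟨i, w⟩)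
  | cluster (c d : C) : GlueLe (.inr c) (.inr d)

/-- Accessibility of the gluing: `c : C` sees the points `r i` with `i ∈ S c`. -/
inductive GlueR : (Σ i, (M i).W) ⊕ C → (Σ i, (M i).W) ⊕ C → Prop
  | old {i : I} {w v : (M i).W} : (M i).R w v → GlueR (.inl ⟨i, w⟩) (.inl ⟨i, v⟩)
  | new {c : C} {i : I} : i ∈ S c → GlueR (.inr c) (.inl ⟨i, r i⟩)

variable (V : ℕ → Prop) (hV : ∀ i ∈ U, ∀ n, V n → (M i).V (r i) n)

/-- The gluing of a family of pointed models below a cluster `C` of new worlds. -/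
def KModel.glue : KModel where
  W := (Σ i, (M i).W) ⊕ C
  le := GlueLe M r U
  R := GlueR M r S
  V x n := x.elim (fun p => (M p.1).V p.2 n) fun _ => V n
  le_refl
    | .inl ⟨i, w⟩ => .old ((M i).le_refl w)
    | .inr c => .cluster c c
  le_trans {u v w} h₁ h₂ := by
    cases h₁ with
    | old h =>
      cases h₂ with
      | old h' => exact .old ((M _).le_trans h h')
    | up hi h =>
      cases h₂ with
      | old h' => exact .up hi ((M _).le_trans h h')
    | cluster =>
      cases h₂ with
      | up hi h' => exact .up hi h'
      | cluster => exact .cluster _ _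
  V_mono {v w n} h hn := by
    cases h with
    | old h => exact (M _).V_mono h hn
    | up hi h => exact (M _).V_mono h (hV _ hi _ hn)
    | cluster => exact hn

variable {M r U S V}

theorem KModel.forces_glue_inl {i : I} {w : (M i).W} {φ : Form} :
    (glue M r U S V hV).Forces (.inl ⟨i, w⟩) φ ↔ (M i).Forces w φ := by
  induction φ generalizing w with
  | var n => exact Iff.rfl
  | bot => exact Iff.rfl
  | and φ ψ ih₁ ih₂ => exact and_congr ih₁ ih₂
  | or φ ψ ih₁ ih₂ => exact or_congr ih₁ ih₂
  | imp φ ψ ih₁ ih₂ =>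
    constructor
    · exact fun h v hv hφ => ih₂.1 (h _ (.old hv) (ih₁.2 hφ))
    · rintro h _ (hv | _ | _) hφ
      exact ih₂.2 (h _ hv (ih₁.1 hφ))
  | box φ ih =>
    constructor
    · exact fun h v hv u hu => ih.1 (h _ (.old hv) _ (.old hu))
    · rintro h _ (hv | _ | _) _ (hu | _)
      exact ih.2 (h _ hv _ hu)
  | dia φ ih =>
    constructor
    · intro h v hv
      obtain ⟨_, hu | _, hf⟩ := h _ (.old hv)
      exact ⟨_, hu, ih.1 hf⟩
    · rintro h _ (hv | _ | _)
      obtain ⟨u, hu, hf⟩ := h _ hv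
      exact ⟨_, .old hu, ih.2 hf⟩

end Glue

/-- Completeness of G4WK: an unprovable sequent to which no invertible rule applies is refuted
at a cluster glued below the countermodels of all smaller unprovable sequents. -/
theorem G4WK.complete (Γ : Multiset Form) (Δ : Option Form) (hv : Valid Γ Δ) : G4WK Γ Δ := by
  induction hn : rankM Γ + rankO Δ using Nat.strong_induction_on generalizing Γ Δ with
  | _ n ih =>
  by_contra hnp
  replace ih : ∀ Γ' Δ', rankM Γ' + rankO Δ' < rankM Γ + rankO Δ → Valid Γ' Δ' → G4WK Γ' Δ' :=
    fun Γ' Δ' h hv => ih _ (hn ▸ h) Γ' Δ' hv rfl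
  clear hn n
  have hbot : Form.bot ∉ Γ := by
    intro h
    obtain ⟨Γ, rfl⟩ := Multiset.exists_cons_of_mem h
    exact hnp (.botL _ _)
  have hand : ∀ φ ψ, Form.and φ ψ ∉ Γ := by
    intro φ ψ h
    obtain ⟨Γ, rfl⟩ := Multiset.exists_cons_of_mem h
    refine hnp (.andL _ _ _ _ (ih _ _ ?_ fun M w hw => hv M w ?_))
    · have := φ.rank_and ψ
      simp only [rankM_cons]
      omega
    · simp only [forcesAll_cons, Forces] at hw ⊢
      tauto
  have hor : ∀ φ ψ, Form.or φ ψ ∉ Γ := by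
    intro φ ψ h
    obtain ⟨Γ, rfl⟩ := Multiset.exists_cons_of_mem h
    have := φ.rank_or ψ
    refine hnp (.orL _ _ _ _ (ih _ _ ?_ fun M w hw => hv M w ?_)
      (ih _ _ ?_ fun M w hw => hv M w ?_))
    · simp only [rankM_cons]
      omega
    · simp only [forcesAll_cons, Forces] at hw ⊢
      tauto
    · simp only [rankM_cons]
      omega
    · simp only [forcesAll_cons, Forces] at hw ⊢
      tauto
  have handimp : ∀ φ ψ χ, Form.imp (Form.and φ ψ) χ ∉ Γ := by
    intro φ ψ χ h
    obtain ⟨Γ, rfl⟩ := Multiset.exists_cons_of_mem h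
    refine hnp (.andImpL _ _ _ _ _ (ih _ _ ?_ fun M w hw => hv M w ?_))
    · have := φ.rank_and_imp ψ χ
      simp only [rankM_cons]
      omega
    · rw [forcesAll_cons] at hw ⊢
      exact ⟨fun v hv h => (hw.1 v hv h.1).mp h.2, hw.2⟩
  have horimp : ∀ φ ψ χ, Form.imp (Form.or φ ψ) χ ∉ Γ := by
    intro φ ψ χ h
    obtain ⟨Γ, rfl⟩ := Multiset.exists_cons_of_mem h
    refine hnp (.orImpL _ _ _ _ _ (ih _ _ ?_ fun M w hw => hv M w ?_))
    · have := φ.rank_or_imp ψ χ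
      simp only [rankM_cons]
      omega
    · simp only [forcesAll_cons] at hw ⊢
      exact ⟨fun v hv h => h.elim (hw.1 v hv) (hw.2.1 v hv), hw.2.2⟩
  have hpimp : ∀ q χ, Form.imp (.var q) χ ∈ Γ → Form.var q ∉ Γ := by
    intro q χ h hq
    obtain ⟨Γ, rfl⟩ := Multiset.exists_cons_of_mem h
    obtain ⟨Γ, rfl⟩ := Multiset.exists_cons_of_mem (a := Form.var q) (s := Γ) (by simpa using hq)
    rw [Multiset.cons_swap] at hnp
    refine hnp (.pImpL _ _ _ _ (ih _ _ ?_ fun M w hw => hv M w ?_))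
    · have := (Form.var q).rank_imp χ
      simp only [rankM_cons]
      omega
    · simp only [forcesAll_cons] at hw ⊢
      exact ⟨fun v hv _ => hw.2.1.mono hv, hw.1, hw.2.2⟩
  have hnext : ∀ α χ, Form.imp α χ ∈ Γ → G4WK (χ ::ₘ Γ.erase (α.imp χ)) Δ := by
    intro α χ h
    refine ih _ _ ?_ fun M w hw => hv M w (forcesAll_of_erase h (fun v hv _ => ?_) ?_)
    · have := α.rank_imp χ
      rw [← rankM_erase h, rankM_cons]
      omega
    · exact (forcesAll_cons.1 hw).1.mono hv
    · exact (forcesAll_cons.1 hw).2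
  have himpimp : ∀ φ ψ χ, Form.imp (Form.imp φ ψ) χ ∈ Γ →
      ¬ G4WK (φ ::ₘ (ψ.imp χ) ::ₘ Γ.erase ((φ.imp ψ).imp χ)) (some ψ) := by
    intro φ ψ χ h hp
    apply hnp
    rw [← Multiset.cons_erase h]
    exact .impImpL _ _ _ _ _ (.impR _ _ _ hp) (hnext _ _ h)
  have hboximp : ∀ φ χ, Form.imp (Form.box φ) χ ∈ Γ → ¬ G4WK (boxInv Γ) (some φ) := by
    intro φ χ h hp
    apply hnp
    rw [← Multiset.cons_erase h, boxInv_cons_of_none rfl] at hp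
    rw [← Multiset.cons_erase h]
    exact .boxImpL _ _ _ _ hp (hnext _ _ h)
  have hdiaimp : ∀ φ χ γ, Form.imp (Form.dia φ) χ ∈ Γ → Form.dia γ ∈ Γ →
      ¬ G4WK (γ ::ₘ boxInv Γ) (some φ) := by
    intro φ χ γ h hγ hp
    have hx := hnext _ _ h
    obtain ⟨Γ, rfl⟩ := Multiset.exists_cons_of_mem h
    obtain ⟨Γ, rfl⟩ := Multiset.exists_cons_of_mem (a := Form.dia γ) (s := Γ) (by simpa using hγ)
    rw [boxInv_cons_of_none rfl, boxInv_cons_of_none rfl] at hp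
    rw [Multiset.erase_cons_head] at hx
    exact hnp (.diaImpL _ _ _ _ _ hp hx)
  have hdia : ∀ γ, Form.dia γ ∈ Γ → ¬ G4WK (γ ::ₘ boxInv Γ) (diaInv Δ) := by
    intro γ h hp
    apply hnp
    rw [← Multiset.cons_erase h]
    rw [← boxInv_erase_dia h] at hp
    exact .diaL' _ _ _ hp
  have hdia_rank : ∀ γ, Form.dia γ ∈ Γ → γ.rank + rankM (boxInv Γ) < rankM Γ := by
    intro γ h
    have := rankM_erase h
    have := γ.rank_dia
    have := rankM_boxInv_le (Γ.erase (Form.dia γ))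
    rw [boxInv_erase_dia h] at this
    omega
  obtain ⟨I, M, r, hI⟩ : ∃ (I : Type) (M : I → KModel) (r : ∀ i, (M i).W), ∀ Γ' Δ',
      rankM Γ' + rankO Δ' < rankM Γ + rankO Δ → ¬ G4WK Γ' Δ' →
      ∃ i, (M i).ForcesAll (r i) Γ' ∧ ¬ (M i).ForcesOpt (r i) Δ' := by
    have hctr : ∀ s : {s : Multiset Form × Option Form //
        rankM s.1 + rankO s.2 < rankM Γ + rankO Δ ∧ ¬ G4WK s.1 s.2},
        ∃ (M : KModel) (w : M.W), M.ForcesAll w s.1.1 ∧ ¬ M.ForcesOpt w s.1.2 := by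
      rintro ⟨s, hs, hp⟩
      simpa [Valid] using mt (ih _ _ hs) hp
    choose M r hr using hctr
    exact ⟨_, M, r, fun Γ' Δ' h hp => ⟨⟨(Γ', Δ'), h, hp⟩, hr _⟩⟩
  let U : Set I := {i | (M i).ForcesAll (r i) Γ}
  let C := {x : Option Form // ∀ γ, Form.dia γ ∈ Γ →
    ∃ i, (M i).ForcesAll (r i) (γ ::ₘ boxInv Γ) ∧ ¬ (M i).ForcesOpt (r i) x}
  let S : C → Set I :=
    fun x => {i | (M i).ForcesAll (r i) (boxInv Γ) ∧ ¬ (M i).ForcesOpt (r i) x.1}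
  let N := glue M r U S (fun n => Form.var n ∈ Γ) (fun i hi n h => hi _ h)
  have hcΔ : ∃ c : C, c.1 = diaInv Δ := by
    refine ⟨⟨diaInv Δ, fun γ hγ => hI _ _ ?_ (hdia γ hγ)⟩, rfl⟩
    have := hdia_rank γ hγ
    have : rankO (diaInv Δ) ≤ rankO Δ := by
      unfold diaInv
      split
      · exact (Form.rank_dia _).le
      · simp
    simp only [rankM_cons]
    omega
  obtain ⟨cΔ, hcΔ⟩ := hcΔ
  have hc₀ : ∃ c : C, c.1 = none :=
    ⟨⟨none, fun γ hγ => (cΔ.2 γ hγ).imp fun i hi => ⟨hi.1, id⟩⟩, rfl⟩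
  obtain ⟨c₀, hc₀⟩ := hc₀
  have hcdia : ∀ φ χ, Form.imp (Form.dia φ) χ ∈ Γ → ∃ c : C, c.1 = some φ := by
    intro φ χ h
    refine ⟨⟨some φ, fun γ hγ => hI _ _ ?_ (hdiaimp φ χ γ h hγ)⟩, rfl⟩
    have hγ' : Form.dia γ ∈ Γ.erase (Form.imp (Form.dia φ) χ) :=
      (Multiset.mem_erase_of_ne (by simp)).2 hγ
    have h₁ := rankM_erase h
    have h₂ := rankM_erase hγ'
    have h₃ := rankM_boxInv_le ((Γ.erase (Form.imp (Form.dia φ) χ)).erase (Form.dia γ))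
    rw [boxInv_erase_dia hγ', boxInv_erase_imp h] at h₃
    have := γ.rank_dia
    have := φ.rank_dia
    have := φ.dia.rank_imp χ
    simp only [rankM_cons, rankO_some]
    omega
  have hbox : ∀ φ, rankM (boxInv Γ) + φ.rank < rankM Γ + rankO Δ →
      ¬ G4WK (boxInv Γ) (some φ) → ∀ c, ¬ N.Forces (.inr c) (Form.box φ) := by
    intro φ hlt hp c hf
    obtain ⟨i, hi, hi'⟩ := hI (boxInv Γ) (some φ) hlt hp
    have hS : i ∈ S c₀ := ⟨hi, by rw [hc₀]; exact id⟩
    exact hi' ((forces_glue_inl _).1 (hf (.inr c₀) (.cluster _ _) _ (.new hS)))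
  have hup : ∀ φ ∈ Γ, ∀ i ∈ U, ∀ v, (M i).le (r i) v → N.Forces (.inl ⟨i, v⟩) φ :=
    fun φ hφ i hi v hv => (forces_glue_inl _).2 ((hi φ hφ).mono hv)
  have hforce : ∀ c, N.ForcesAll (.inr c) Γ := by
    intro c φ h
    cases φ with
    | var n => exact h
    | bot => exact (hbot h).elim
    | and φ ψ => exact (hand _ _ h).elim
    | or φ ψ => exact (hor _ _ h).elim
    | box φ =>
      rintro _ (_ | ⟨hi, hv⟩ | ⟨_, d⟩) u hu
      · exact hup _ h _ hi _ hv _ (N.le_refl _) _ hu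
      · obtain _ | hi := hu
        exact (forces_glue_inl _).2 (hi.1 _ (mem_boxInv.2 h))
    | dia φ =>
      rintro _ (_ | ⟨hi, hv⟩ | ⟨_, d⟩)
      · exact hup _ h _ hi _ hv _ (N.le_refl _)
      · obtain ⟨i, hi, hi'⟩ := d.2 φ h
        rw [forcesAll_cons] at hi
        exact ⟨_, .new ⟨hi.2, hi'⟩, (forces_glue_inl _).2 hi.1⟩
    | imp α χ =>
      rintro _ (_ | ⟨hi, hv⟩ | ⟨_, d⟩) hα
      · exact (hup _ h _ hi _ hv).mp hα
      · exfalso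
        cases α with
        | var n => exact hpimp _ _ h hα
        | bot => exact hα
        | and φ ψ => exact handimp _ _ _ h
        | or φ ψ => exact horimp _ _ _ h
        | box φ =>
          refine hbox φ ?_ (hboximp _ _ h) _ hα
          have h₁ := rankM_erase h
          have h₂ := rankM_boxInv_le (Γ.erase (Form.imp (Form.box φ) χ))
          rw [boxInv_erase_imp h] at h₂
          have := φ.rank_box
          have := φ.box.rank_imp χ
          omega
        | dia φ =>
          obtain ⟨c, hc⟩ := hcdia _ _ h
          obtain ⟨_, _ | hi, hf⟩ := hα (.inr c) (.cluster _ _)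
          exact hi.2 (hc ▸ (forces_glue_inl _).1 hf)
        | imp φ ψ =>
          have hlt : rankM (φ ::ₘ (ψ.imp χ) ::ₘ Γ.erase ((φ.imp ψ).imp χ)) + rankO (some ψ)
              < rankM Γ + rankO Δ := by
            have h₁ := rankM_erase h
            have h₂ := φ.rank_imp_imp ψ χ
            have h₃ := φ.rank_imp ψ
            simp only [rankM_cons, rankO_some]
            omega
          obtain ⟨i, hi, hi'⟩ := hI _ _ hlt (himpimp _ _ _ h)
          simp only [forcesAll_cons] at hi
          have hU : i ∈ U := forcesAll_of_erase h
            (fun v hv hφψ => (hi.2.1.mono hv).mp (hφψ.mp (hi.1.mono hv))) hi.2.2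
          have hψ := hα (.inl ⟨i, r i⟩) (.up hU ((M i).le_refl _)) ((forces_glue_inl _).2 hi.1)
          exact hi' ((forces_glue_inl _).1 hψ)
  have hfor : ∀ φ, φ.rank < rankO Δ → N.Forces (.inr c₀) φ → G4WK Γ (some φ) := by
    intro φ hlt hf
    by_contra hp
    obtain ⟨i, hi, hi'⟩ := hI Γ (some φ) (by simpa using hlt) hp
    exact hi' ((forces_glue_inl _).1 (hf.mono (.up hi ((M i).le_refl _))))
  have hΔ := hv N (.inr c₀) (hforce c₀)
  obtain _ | δ := Δ
  · exact hΔ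
  cases δ with
  | bot => exact hΔ
  | var q =>
    obtain ⟨Γ, rfl⟩ := Multiset.exists_cons_of_mem (show Form.var q ∈ Γ from hΔ)
    exact hnp (.idP _ _)
  | and φ ψ =>
    have := φ.rank_and ψ
    have := φ.rank_pos
    have := ψ.rank_pos
    exact hnp (.andR _ _ _ (hfor φ (by rw [rankO_some]; omega) hΔ.1)
      (hfor ψ (by rw [rankO_some]; omega) hΔ.2))
  | or φ ψ =>
    have := φ.rank_or ψ
    have := φ.rank_pos
    have := ψ.rank_pos
    obtain hΔ | hΔ := hΔ
    · exact hnp (.orR1 _ _ _ (hfor φ (by rw [rankO_some]; omega) hΔ))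
    · exact hnp (.orR2 _ _ _ (hfor ψ (by rw [rankO_some]; omega) hΔ))
  | imp φ ψ =>
    refine hnp (.impR _ _ _ (ih _ _ ?_ fun M w hw => ?_))
    · have := φ.rank_imp ψ
      simp only [rankM_cons, rankO_some]
      omega
    · rw [forcesAll_cons] at hw
      exact (hv M w hw.2).mp hw.1
  | box φ =>
    refine hbox φ ?_ (fun hp => hnp (.boxR _ _ hp)) _ hΔ
    have := rankM_boxInv_le Γ
    have := φ.rank_box
    simp only [rankO_some]
    omega
  | dia φ =>
    obtain ⟨_, _ | hi, hf⟩ := hΔ (.inr cΔ) (.cluster _ _)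
    exact hi.2 (hcΔ ▸ (forces_glue_inl _).1 hf)
/-! ### Interpolants as approximants of semantic conditions -/

@[simp] theorem varsM_cons (φ : Form) (Γ : Multiset Form) :
    varsM (φ ::ₘ Γ) = vars φ ∪ varsM Γ := by
  ext n
  simp [varsM]

theorem varsM_boxInv_subset (Γ : Multiset Form) : varsM (boxInv Γ) ⊆ varsM Γ :=
  fun _ ⟨φ, hφ, hn⟩ => ⟨φ.box, mem_boxInv.1 hφ, hn⟩

/-- A condition on pointed models. -/
abbrev PointProp := ∀ M : KModel, M.W → Prop

/-- Some formula over the variables `V` is implied by `S` and implies `Q`. -/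
def Itp (V : Set ℕ) (S Q : PointProp) : Prop :=
  ∃ e, vars e ⊆ V ∧ (∀ M w, S M w → M.Forces w e) ∧ ∀ M w, M.Forces w e → Q M w

namespace Itp

variable {V V' : Set ℕ} {S Q S' Q' S₁ Q₁ S₂ Q₂ : PointProp}

theorem mono (h : Itp V S Q) (hV : V ⊆ V') (hS : ∀ M w, S' M w → S M w)
    (hQ : ∀ M w, Q M w → Q' M w) : Itp V' S' Q' := by
  obtain ⟨e, he, h₁, h₂⟩ := h
  exact ⟨e, he.trans hV, fun M w h => h₁ M w (hS M w h), fun M w h => hQ M w (h₂ M w h)⟩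

theorem top (hQ : ∀ M w, Q M w) : Itp V S Q :=
  ⟨Form.bot.imp .bot, by simp [vars], fun _ _ _ _ _ h => h, fun M w _ => hQ M w⟩

theorem bot (hS : ∀ M w, ¬ S M w) : Itp V S Q :=
  ⟨.bot, by simp [vars], fun M w h => (hS M w h).elim, fun _ _ h => h.elim⟩

theorem and (h₁ : Itp V S₁ Q₁) (h₂ : Itp V S₂ Q₂) :
    Itp V (fun M w => S₁ M w ∧ S₂ M w) (fun M w => Q₁ M w ∧ Q₂ M w) := by
  obtain ⟨a, ha, ha₁, ha₂⟩ := h₁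
  obtain ⟨b, hb, hb₁, hb₂⟩ := h₂
  exact ⟨a.and b, Set.union_subset ha hb, fun M w h => ⟨ha₁ M w h.1, hb₁ M w h.2⟩,
    fun M w h => ⟨ha₂ M w h.1, hb₂ M w h.2⟩⟩

theorem or (h₁ : Itp V S₁ Q₁) (h₂ : Itp V S₂ Q₂) :
    Itp V (fun M w => S₁ M w ∨ S₂ M w) (fun M w => Q₁ M w ∨ Q₂ M w) := by
  obtain ⟨a, ha, ha₁, ha₂⟩ := h₁
  obtain ⟨b, hb, hb₁, hb₂⟩ := h₂
  exact ⟨a.or b, Set.union_subset ha hb, fun M w h => h.imp (ha₁ M w) (hb₁ M w),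
    fun M w h => Or.imp (ha₂ M w) (hb₂ M w) h⟩

theorem imp (h₁ : Itp V S₁ Q₁) (h₂ : Itp V S₂ Q₂) :
    Itp V (fun M w => ∀ v, M.le w v → Q₁ M v → S₂ M v)
      (fun M w => ∀ v, M.le w v → S₁ M v → Q₂ M v) := by
  obtain ⟨a, ha, ha₁, ha₂⟩ := h₁
  obtain ⟨b, hb, hb₁, hb₂⟩ := h₂
  exact ⟨a.imp b, Set.union_subset ha hb,
    fun M w h v hv hf => hb₁ M v (h v hv (ha₂ M v hf)),
    fun M w h v hv hs => hb₂ M v (h v hv (ha₁ M v hs))⟩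

theorem box (h : Itp V S Q) :
    Itp V (fun M w => ∀ v, M.le w v → ∀ u, M.R v u → S M u)
      (fun M w => ∀ v, M.le w v → ∀ u, M.R v u → Q M u) := by
  obtain ⟨a, ha, h₁, h₂⟩ := h
  exact ⟨a.box, ha, fun M w h v hv u hu => h₁ M u (h v hv u hu),
    fun M w h v hv u hu => h₂ M u (h v hv u hu)⟩

theorem dia (h : Itp V S Q) :
    Itp V (fun M w => ∀ v, M.le w v → ∃ u, M.R v u ∧ S M u)
      (fun M w => ∀ v, M.le w v → ∃ u, M.R v u ∧ Q M u) := by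
  obtain ⟨a, ha, h₁, h₂⟩ := h
  exact ⟨a.dia, ha, fun M w h v hv => (h v hv).imp fun u hu => ⟨hu.1, h₁ M u hu.2⟩,
    fun M w h v hv => Exists.imp (fun u hu => ⟨hu.1, h₂ M u hu.2⟩) (h v hv)⟩

theorem up (h : Itp V S Q) : Itp V S (fun M w => ∀ v, M.le w v → Q M v) := by
  obtain ⟨a, ha, h₁, h₂⟩ := h
  exact ⟨a, ha, h₁, fun M w h v hv => h₂ M v (Forces.mono hv h)⟩

theorem forallMem {F G : Form → PointProp} {Γ : Multiset Form}
    (h : ∀ φ ∈ Γ, Itp V (F φ) (G φ)) :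
    Itp V (fun M w => ∀ φ ∈ Γ, F φ M w) (fun M w => ∀ φ ∈ Γ, G φ M w) := by
  induction Γ using Multiset.induction with
  | empty => exact top (by simp)
  | cons φ Γ ih =>
    simp only [Multiset.mem_cons, forall_eq_or_imp] at h ⊢
    exact h.1.and (ih h.2)

theorem existsMem {F G : Form → PointProp} {Γ : Multiset Form}
    (h : ∀ φ ∈ Γ, Itp V (F φ) (G φ)) :
    Itp V (fun M w => ∃ φ ∈ Γ, F φ M w) (fun M w => ∃ φ ∈ Γ, G φ M w) := by
  induction Γ using Multiset.induction with
  | empty => exact bot (by simp)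
  | cons φ Γ ih =>
    simp only [Multiset.mem_cons, forall_eq_or_imp, exists_eq_or_imp] at h ⊢
    exact h.1.or (ih h.2)

theorem var {q : ℕ} (h : q ∈ V) : Itp V (fun M w => M.V w q) (fun M w => M.V w q) :=
  ⟨.var q, by simpa [vars], fun _ _ h => h, fun _ _ h => h⟩

end Itp

/-- The condition defining the universal interpolant `∀p.(Γ ⇒ Δ)`. -/
def AU (p : ℕ) (Γ : Multiset Form) (Δ : Option Form) : PointProp := fun M w =>
  ∃ Θ, p ∉ varsM Θ ∧ M.ForcesAll w Θ ∧ G4WK (Θ + Γ) Δ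

/-- The condition defining the existential interpolant `∃p.Γ`. -/
def EU (p : ℕ) (Γ : Multiset Form) : PointProp := fun M w =>
  ∀ Θ Δ, p ∉ varsM Θ → p ∉ varsO Δ → G4WK (Θ + Γ) Δ → M.ForcesAll w Θ → M.ForcesOpt w Δ

/-- `AU` for a boxed succedent whose proof ends with the rule for □. -/
def BoxU (p : ℕ) (φ : Form) (Γ : Multiset Form) : PointProp := fun M w =>
  ∃ Θ, p ∉ varsM Θ ∧ M.ForcesAll w Θ ∧ G4WK (boxInv Θ + boxInv Γ) (some φ)

/-- `AU` for a diamond succedent whose proof ends with the rule for ◇. -/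
def DiaU (p : ℕ) (φ : Form) (Γ : Multiset Form) : PointProp := fun M w =>
  ∃ Θ, p ∉ varsM Θ ∧ M.ForcesAll w Θ ∧
    ∃ γ, Form.dia γ ∈ Θ + Γ ∧ G4WK (γ ::ₘ (boxInv Θ + boxInv Γ)) (some φ)

/-- Some formula over the admissible variables separates `Γ` from `EU p Γ`. -/
def HasE (p : ℕ) (Γ : Multiset Form) : Prop :=
  Itp (varsM Γ \ {p}) (fun M w => M.ForcesAll w Γ) (EU p Γ)

/-- Some formula over the admissible variables separates `AU p Γ Δ` from `Γ ⇒ Δ`. -/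
def HasA (p : ℕ) (Γ : Multiset Form) (Δ : Option Form) : Prop :=
  Itp ((varsM Γ ∪ varsO Δ) \ {p}) (AU p Γ Δ) (fun M w => M.ForcesAll w Γ → M.ForcesOpt w Δ)

/-- The condition under which an implication `α → χ` beside `Γ` can be principal. -/
def ImpU (p : ℕ) (α χ : Form) (Γ : Multiset Form) : PointProp := fun M w =>
  match α with
  | .var q => Form.var q ∈ Γ ∨ (q ≠ p ∧ M.V w q)
  | .imp β γ => AU p (γ.imp χ ::ₘ Γ) (some (β.imp γ)) M w
  | .box φ => BoxU p φ Γ M w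
  | .dia φ => DiaU p φ Γ M w
  | _ => False

/-- The contribution of a formula `φ` beside `Γ` to the existential interpolant. -/
def LeftE (p : ℕ) (Γ : Multiset Form) (φ : Form) : PointProp := fun M w =>
  match φ with
  | .var q => q ≠ p → M.V w q
  | .bot => False
  | .and α β => EU p (α ::ₘ β ::ₘ Γ) M w
  | .or α β => EU p (α ::ₘ Γ) M w ∨ EU p (β ::ₘ Γ) M w
  | .imp (.and α β) χ => EU p (α.imp (β.imp χ) ::ₘ Γ) M w
  | .imp (.or α β) χ => EU p (α.imp χ ::ₘ β.imp χ ::ₘ Γ) M w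
  | .imp α χ => ImpU p α χ Γ M w → EU p (χ ::ₘ Γ) M w
  | .box _ => True
  | .dia γ => ∃ u, M.R w u ∧ EU p (γ ::ₘ boxInv Γ) M u

/-- The contribution of a formula `φ` beside `Γ` to the universal interpolant. -/
def LeftA (p : ℕ) (Γ : Multiset Form) (Δ : Option Form) (φ : Form) : PointProp := fun M w =>
  match φ with
  | .and α β => AU p (α ::ₘ β ::ₘ Γ) Δ M w
  | .or α β => AU p (α ::ₘ Γ) Δ M w ∧ AU p (β ::ₘ Γ) Δ M w
  | .imp (.and α β) χ => AU p (α.imp (β.imp χ) ::ₘ Γ) Δ M w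
  | .imp (.or α β) χ => AU p (α.imp χ ::ₘ β.imp χ ::ₘ Γ) Δ M w
  | .imp α χ => ImpU p α χ Γ M w ∧ AU p (χ ::ₘ Γ) Δ M w
  | _ => False

/-- The contribution of the succedent to the universal interpolant. -/
def RightA (p : ℕ) (Γ : Multiset Form) (Δ : Option Form) : PointProp := fun M w =>
  match Δ with
  | some (.var q) => Form.var q ∈ Γ ∨ (q ≠ p ∧ M.V w q)
  | some (.and α β) => AU p Γ (some α) M w ∧ AU p Γ (some β) M w
  | some (.or α β) => AU p Γ (some α) M w ∨ AU p Γ (some β) M w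
  | some (.imp α β) => AU p (α ::ₘ Γ) (some β) M w
  | some (.box φ) => BoxU p φ Γ M w
  | some (.dia φ) => DiaU p φ Γ M w
  | _ => False

/-! ### Existence of formulas for the individual contributions -/

theorem itp_box {p : ℕ} {φ : Form} {Γ : Multiset Form} (h : HasA p (boxInv Γ) (some φ)) :
    Itp ((varsM Γ ∪ vars φ) \ {p}) (BoxU p φ Γ)
      (fun M w => M.ForcesAll w Γ → M.Forces w φ.box) := by
  refine (Itp.box h).mono ?_ ?_ ?_
  · exact Set.sdiff_subset_sdiff_left
      (Set.union_subset_union_left _ (varsM_boxInv_subset Γ))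
  · rintro M w ⟨Θ, hp, hf, hd⟩ v hv u hu
    exact ⟨boxInv Θ, fun h => hp (varsM_boxInv_subset Θ h), (hf.mono hv).boxInv hu, hd⟩
  · exact fun M w h hf v hv u hu => h v hv u hu ((hf.mono hv).boxInv hu)

theorem itp_dia {p : ℕ} {φ : Form} {Γ : Multiset Form} (h : HasA p (boxInv Γ) (some φ))
    (hγ : ∀ γ, Form.dia γ ∈ Γ → HasA p (γ ::ₘ boxInv Γ) (some φ)) :
    Itp ((varsM Γ ∪ vars φ) \ {p}) (DiaU p φ Γ)
      (fun M w => M.ForcesAll w Γ → M.Forces w φ.dia) := by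
  have key : ∀ ψ ∈ Γ, Itp ((varsM Γ ∪ vars φ) \ {p})
      (fun M w => ∃ γ, ψ = Form.dia γ ∧ ∀ v, M.le w v → ∀ u, M.R v u →
        AU p (γ ::ₘ boxInv Γ) (some φ) M u)
      (fun M w => M.ForcesAll w Γ → M.Forces w φ.dia) := by
    intro ψ hψ
    by_cases hd : ∃ γ, ψ = Form.dia γ
    · obtain ⟨γ, rfl⟩ := hd
      refine (Itp.box (hγ γ hψ)).mono ?_ ?_ ?_
      · refine Set.sdiff_subset_sdiff_left (Set.union_subset_union_left _ ?_)
        rw [varsM_cons]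
        exact Set.union_subset (fun n hn => ⟨_, hψ, hn⟩) (varsM_boxInv_subset Γ)
      · rintro M w ⟨γ', he, h⟩
        cases he
        exact h
      · intro M w h hf v hv
        obtain ⟨u, hu, hfu⟩ := hf _ hψ v hv
        exact ⟨u, hu, h v hv u hu (forcesAll_cons.2 ⟨hfu, (hf.mono hv).boxInv hu⟩)⟩
    · exact Itp.bot fun M w ⟨γ, he, _⟩ => hd ⟨γ, he⟩
  refine (Itp.or ((Itp.dia h).mono (Set.sdiff_subset_sdiff_left
      (Set.union_subset_union_left _ (varsM_boxInv_subset Γ))) (fun _ _ h => h)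
      (fun _ _ h => h)) (Itp.existsMem key)).mono subset_rfl ?_ ?_
  · rintro M w ⟨Θ, hp, hf, γ, hm, hd⟩
    have hp' : p ∉ varsM (boxInv Θ) := fun h => hp (varsM_boxInv_subset Θ h)
    rcases Multiset.mem_add.1 hm with hm | hm
    · left
      intro v hv
      obtain ⟨u, hu, hfu⟩ := hf _ hm v hv
      refine ⟨u, hu, γ ::ₘ boxInv Θ, ?_,
        forcesAll_cons.2 ⟨hfu, (hf.mono hv).boxInv hu⟩, by rwa [Multiset.cons_add]⟩
      rw [varsM_cons]
      exact fun h => h.elim (fun h => hp ⟨_, hm, h⟩) hp'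
    · refine Or.inr ⟨_, hm, γ, rfl, fun v hv u hu => ?_⟩
      exact ⟨boxInv Θ, hp', (hf.mono hv).boxInv hu, by rwa [Multiset.add_cons]⟩
  · rintro M w (h | ⟨_, _, h⟩) hf
    · intro v hv
      obtain ⟨u, hu, h⟩ := h v hv
      exact ⟨u, hu, h ((hf.mono hv).boxInv hu)⟩
    · exact h hf

theorem itp_var {p q : ℕ} {Γ : Multiset Form} {V : Set ℕ} (h : q ≠ p → q ∈ V) :
    Itp V (fun M w => Form.var q ∈ Γ ∨ (q ≠ p ∧ M.V w q))
      (fun M w => M.ForcesAll w Γ → M.V w q) := by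
  by_cases hm : Form.var q ∈ Γ
  · exact Itp.top fun M w hf => hf _ hm
  by_cases hq : q = p
  · exact Itp.bot fun M w h => h.elim hm fun h => h.1 hq
  · exact (Itp.var (h hq)).mono subset_rfl (by simp [hm]) (fun _ _ h _ => h)

section Step

variable {p : ℕ} {Γ : Multiset Form} {Δ : Option Form} {φ α χ : Form}

theorem itp_imp (ih : ∀ Γ' Δ', rankM Γ' + rankO Δ' < rankM (α.imp χ ::ₘ Γ) → HasA p Γ' Δ') :
    Itp (varsM (α.imp χ ::ₘ Γ) \ {p}) (ImpU p α χ Γ)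
      (fun M w => M.ForcesAll w (α.imp χ ::ₘ Γ) → M.Forces w α) := by
  have hr := Form.rank_imp α χ
  have hΓ := rankM_boxInv_le Γ
  simp only [rankM_cons] at ih
  cases α with
  | var q =>
    refine (itp_var (p := p) (q := q) (Γ := Γ) ?_).mono subset_rfl (fun _ _ h => h) ?_
    · simp +contextual [vars]
    · exact fun M w h hf => h (forcesAll_cons.1 hf).2
  | bot => exact Itp.bot fun M w h => h
  | and => exact Itp.bot fun M w h => h
  | or => exact Itp.bot fun M w h => h
  | imp β γ =>
    have hr' := Form.rank_imp_imp β γ χ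
    refine Itp.mono (ih (γ.imp χ ::ₘ Γ) (some (β.imp γ))
      (by simp only [rankM_cons, rankO_some]; omega)) ?_ (fun _ _ h => h) ?_
    · intro n
      simp only [varsM_cons, vars, varsO, Set.mem_sdiff, Set.mem_union]
      tauto
    · intro M w h hf
      rw [forcesAll_cons] at hf
      refine h (forcesAll_cons.2 ⟨fun v hv hγ => ?_, hf.2⟩)
      exact hf.1 v hv fun v' hv' _ => hγ.mono hv'
  | box β =>
    have := β.rank_box
    refine (itp_box (ih (boxInv Γ) (some β) (by simp only [rankO_some]; omega))).mono ?_
      (fun _ _ h => h) ?_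
    · intro n
      simp only [varsM_cons, vars, Set.mem_sdiff, Set.mem_union]
      tauto
    · exact fun M w h hf => h (forcesAll_cons.1 hf).2
  | dia β =>
    have := β.rank_dia
    refine (itp_dia (ih (boxInv Γ) (some β) (by simp only [rankO_some]; omega)) ?_).mono ?_
      (fun _ _ h => h) ?_
    · intro γ hγ
      have h₁ := γ.rank_dia
      have h₂ := rankM_erase hγ
      have h₃ := rankM_boxInv_le (Γ.erase γ.dia)
      rw [boxInv_erase_dia hγ] at h₃
      exact ih _ _ (by simp only [rankM_cons, rankO_some]; omega)
    · intro n
      simp only [varsM_cons, vars, Set.mem_sdiff, Set.mem_union]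
      tauto
    · exact fun M w h hf => h (forcesAll_cons.1 hf).2

theorem itp_leftE (ihE : ∀ Γ', rankM Γ' < rankM (φ ::ₘ Γ) → HasE p Γ')
    (ihA : ∀ Γ' Δ', rankM Γ' + rankO Δ' < rankM (φ ::ₘ Γ) → HasA p Γ' Δ') :
    Itp (varsM (φ ::ₘ Γ) \ {p}) (fun M w => M.ForcesAll w (φ ::ₘ Γ)) (LeftE p Γ φ) := by
  have key : ∀ {α χ}, φ = α.imp χ → Itp (varsM (φ ::ₘ Γ) \ {p})
      (fun M w => M.ForcesAll w (φ ::ₘ Γ))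
      (fun M w => ImpU p α χ Γ M w → EU p (χ ::ₘ Γ) M w) := by
    rintro α χ rfl
    have hr := Form.rank_imp α χ
    have hχ : HasE p (χ ::ₘ Γ) := ihE _ (by simp only [rankM_cons]; omega)
    refine ((itp_imp ihA).imp (hχ.mono ?_ (fun _ _ h => h) (fun _ _ h => h))).mono
      subset_rfl ?_ ?_
    · intro n
      simp only [varsM_cons, vars, Set.mem_sdiff, Set.mem_union]
      tauto
    · intro M w hf v hv hα
      replace hf := hf.mono hv
      have hf' := forcesAll_cons.1 hf
      exact forcesAll_cons.2 ⟨hf'.1.mp (hα hf), hf'.2⟩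
    · exact fun M w h hi => h w (M.le_refl w) hi
  have hΓ := rankM_boxInv_le Γ
  simp only [rankM_cons] at ihE
  cases φ with
  | var q =>
    by_cases hq : q = p
    · exact Itp.top fun M w h => (h hq).elim
    · refine (Itp.var ?_).mono subset_rfl (fun M w h => (forcesAll_cons.1 h).1)
        (fun M w h _ => h)
      simp [vars, hq]
  | bot => exact Itp.bot fun M w h => (forcesAll_cons.1 h).1
  | and α β =>
    have hr := Form.rank_and α β
    refine Itp.mono (ihE (α ::ₘ β ::ₘ Γ) (by simp only [rankM_cons]; omega)) ?_ ?_
      (fun _ _ h => h)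
    · intro n
      simp only [varsM_cons, vars, Set.mem_sdiff, Set.mem_union]
      tauto
    · intro M w h
      simp only [forcesAll_cons, Forces] at h ⊢
      tauto
  | or α β =>
    have hr := Form.rank_or α β
    have hs : ∀ ψ, vars ψ ⊆ vars (α.or β) →
        varsM (ψ ::ₘ Γ) \ {p} ⊆ varsM (α.or β ::ₘ Γ) \ {p} := by
      intro ψ hψ
      rw [varsM_cons, varsM_cons]
      exact Set.sdiff_subset_sdiff_left (Set.union_subset_union_left _ hψ)
    refine Itp.mono (Itp.or
      (Itp.mono (ihE (α ::ₘ Γ) (by simp only [rankM_cons]; omega))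
        (hs α Set.subset_union_left) (fun _ _ h => h) (fun _ _ h => h))
      (Itp.mono (ihE (β ::ₘ Γ) (by simp only [rankM_cons]; omega))
        (hs β Set.subset_union_right) (fun _ _ h => h) (fun _ _ h => h)))
      subset_rfl ?_ (fun _ _ h => h)
    intro M w h
    simp only [forcesAll_cons, Forces] at h ⊢
    tauto
  | imp α χ =>
    cases α with
    | and α β =>
      have hr := Form.rank_and_imp α β χ
      refine Itp.mono (ihE (α.imp (β.imp χ) ::ₘ Γ) (by simp only [rankM_cons]; omega)) ?_ ?_
        (fun _ _ h => h)
      · intro n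
        simp only [varsM_cons, vars, Set.mem_sdiff, Set.mem_union]
        tauto
      · intro M w h
        rw [forcesAll_cons] at h ⊢
        refine ⟨fun v hv hα v' hv' hβ => ?_, h.2⟩
        exact h.1 v' (M.le_trans hv hv') ⟨hα.mono hv', hβ⟩
    | or α β =>
      have hr := Form.rank_or_imp α β χ
      refine Itp.mono (ihE (α.imp χ ::ₘ β.imp χ ::ₘ Γ) (by simp only [rankM_cons]; omega))
        ?_ ?_ (fun _ _ h => h)
      · intro n
        simp only [varsM_cons, vars, Set.mem_sdiff, Set.mem_union]
        tauto
      · intro M w h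
        simp only [forcesAll_cons] at h ⊢
        exact ⟨fun v hv hα => h.1 v hv (Or.inl hα), fun v hv hα => h.1 v hv (Or.inr hα), h.2⟩
    | _ => exact key rfl
  | box => exact Itp.top fun M w => trivial
  | dia γ =>
    have hr := γ.rank_dia
    refine (Itp.dia (ihE (γ ::ₘ boxInv Γ) (by simp only [rankM_cons]; omega))).mono ?_ ?_ ?_
    · rw [varsM_cons, varsM_cons]
      exact Set.sdiff_subset_sdiff_left (Set.union_subset_union_right _
        (varsM_boxInv_subset Γ))
    · intro M w hf v hv
      have hf' := forcesAll_cons.1 (hf.mono hv)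
      obtain ⟨u, hu, hγ⟩ := hf'.1 v (M.le_refl v)
      exact ⟨u, hu, forcesAll_cons.2 ⟨hγ, hf'.2.boxInv hu⟩⟩
    · exact fun M w h => h w (M.le_refl w)

theorem itp_leftA
    (ihA : ∀ Γ' Δ', rankM Γ' + rankO Δ' < rankM (φ ::ₘ Γ) + rankO Δ → HasA p Γ' Δ') :
    Itp ((varsM (φ ::ₘ Γ) ∪ varsO Δ) \ {p}) (LeftA p Γ Δ φ)
      (fun M w => M.ForcesAll w (φ ::ₘ Γ) → M.ForcesOpt w Δ) := by
  have key : ∀ {α χ}, φ = α.imp χ → Itp ((varsM (φ ::ₘ Γ) ∪ varsO Δ) \ {p})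
      (fun M w => ImpU p α χ Γ M w ∧ AU p (χ ::ₘ Γ) Δ M w)
      (fun M w => M.ForcesAll w (φ ::ₘ Γ) → M.ForcesOpt w Δ) := by
    rintro α χ rfl
    have hr := Form.rank_imp α χ
    have hχ : HasA p (χ ::ₘ Γ) Δ := ihA _ _ (by simp only [rankM_cons]; omega)
    refine (((itp_imp fun Γ' Δ' h => ihA Γ' Δ' (by omega)).mono
      (Set.sdiff_subset_sdiff_left Set.subset_union_left) (fun _ _ h => h)
      (fun _ _ h => h)).and (hχ.mono ?_ (fun _ _ h => h) (fun _ _ h => h))).mono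
      subset_rfl (fun _ _ h => h) ?_
    · intro n
      simp only [varsM_cons, vars, Set.mem_sdiff, Set.mem_union]
      tauto
    · intro M w h hf
      have hf' := forcesAll_cons.1 hf
      exact h.2 (forcesAll_cons.2 ⟨hf'.1.mp (h.1 hf), hf'.2⟩)
  simp only [rankM_cons] at ihA
  cases φ with
  | and α β =>
    have hr := Form.rank_and α β
    refine Itp.mono (ihA (α ::ₘ β ::ₘ Γ) Δ (by simp only [rankM_cons]; omega)) ?_
      (fun _ _ h => h) ?_
    · intro n
      simp only [varsM_cons, vars, Set.mem_sdiff, Set.mem_union]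
      tauto
    · intro M w h hf
      apply h
      simp only [forcesAll_cons, Forces] at hf ⊢
      tauto
  | or α β =>
    have hr := Form.rank_or α β
    have hs : ∀ ψ, vars ψ ⊆ vars (α.or β) → (varsM (ψ ::ₘ Γ) ∪ varsO Δ) \ {p} ⊆
        (varsM (α.or β ::ₘ Γ) ∪ varsO Δ) \ {p} := by
      intro ψ hψ
      rw [varsM_cons, varsM_cons]
      exact Set.sdiff_subset_sdiff_left
        (Set.union_subset_union_left _ (Set.union_subset_union_left _ hψ))
    refine Itp.mono (Itp.and
      (Itp.mono (ihA (α ::ₘ Γ) Δ (by simp only [rankM_cons]; omega))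
        (hs α Set.subset_union_left) (fun _ _ h => h) (fun _ _ h => h))
      (Itp.mono (ihA (β ::ₘ Γ) Δ (by simp only [rankM_cons]; omega))
        (hs β Set.subset_union_right) (fun _ _ h => h) (fun _ _ h => h)))
      subset_rfl (fun _ _ h => h) ?_
    intro M w h hf
    simp only [forcesAll_cons, Forces] at h hf
    tauto
  | imp α χ =>
    cases α with
    | and α β =>
      have hr := Form.rank_and_imp α β χ
      refine Itp.mono (ihA (α.imp (β.imp χ) ::ₘ Γ) Δ (by simp only [rankM_cons]; omega)) ?_
        (fun _ _ h => h) ?_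
      · intro n
        simp only [varsM_cons, vars, Set.mem_sdiff, Set.mem_union]
        tauto
      · intro M w h hf
        rw [forcesAll_cons] at hf
        refine h (forcesAll_cons.2 ⟨fun v hv hα v' hv' hβ => ?_, hf.2⟩)
        exact hf.1 v' (M.le_trans hv hv') ⟨hα.mono hv', hβ⟩
    | or α β =>
      have hr := Form.rank_or_imp α β χ
      refine Itp.mono (ihA (α.imp χ ::ₘ β.imp χ ::ₘ Γ) Δ (by simp only [rankM_cons]; omega))
        ?_ (fun _ _ h => h) ?_
      · intro n
        simp only [varsM_cons, vars, Set.mem_sdiff, Set.mem_union]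
        tauto
      · intro M w h hf
        apply h
        simp only [forcesAll_cons] at hf ⊢
        exact ⟨fun v hv hα => hf.1 v hv (Or.inl hα), fun v hv hα => hf.1 v hv (Or.inr hα),
          hf.2⟩
    | _ => exact key rfl
  | _ => exact Itp.bot fun M w h => h

theorem itp_rightA
    (ihA : ∀ Γ' Δ', rankM Γ' + rankO Δ' < rankM Γ + rankO Δ → HasA p Γ' Δ') :
    Itp ((varsM Γ ∪ varsO Δ) \ {p}) (RightA p Γ Δ)
      (fun M w => M.ForcesAll w Γ → M.ForcesOpt w Δ) := by
  have hΓ := rankM_boxInv_le Γ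
  cases Δ with
  | none => exact Itp.bot fun M w h => h
  | some δ =>
  simp only [rankO_some] at ihA
  cases δ with
  | var q => exact itp_var fun h => by simp [varsO, vars, h]
  | bot => exact Itp.bot fun M w h => h
  | and α β =>
    have hr := Form.rank_and α β
    refine Itp.mono (Itp.and
      (Itp.mono (ihA Γ (some α) (by simp only [rankO_some]; omega)) ?_
        (fun _ _ h => h) (fun _ _ h => h))
      (Itp.mono (ihA Γ (some β) (by simp only [rankO_some]; omega)) ?_
        (fun _ _ h => h) (fun _ _ h => h))) subset_rfl (fun _ _ h => h) ?_
    · exact Set.sdiff_subset_sdiff_left (Set.union_subset_union_right _ Set.subset_union_left)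
    · exact Set.sdiff_subset_sdiff_left (Set.union_subset_union_right _ Set.subset_union_right)
    · exact fun M w h hf => ⟨h.1 hf, h.2 hf⟩
  | or α β =>
    have hr := Form.rank_or α β
    refine Itp.mono (Itp.or
      (Itp.mono (ihA Γ (some α) (by simp only [rankO_some]; omega)) ?_
        (fun _ _ h => h) (fun _ _ h => h))
      (Itp.mono (ihA Γ (some β) (by simp only [rankO_some]; omega)) ?_
        (fun _ _ h => h) (fun _ _ h => h))) subset_rfl (fun _ _ h => h) ?_
    · exact Set.sdiff_subset_sdiff_left (Set.union_subset_union_right _ Set.subset_union_left)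
    · exact Set.sdiff_subset_sdiff_left (Set.union_subset_union_right _ Set.subset_union_right)
    · exact fun M w h hf => h.imp (fun h => h hf) (fun h => h hf)
  | imp α β =>
    have hr := Form.rank_imp α β
    refine (Itp.up (ihA (α ::ₘ Γ) (some β)
      (by simp only [rankM_cons, rankO_some]; omega))).mono ?_ (fun _ _ h => h) ?_
    · intro n
      simp only [varsM_cons, varsO, vars, Set.mem_sdiff, Set.mem_union]
      tauto
    · exact fun M w h hf v hv hα => h v hv (forcesAll_cons.2 ⟨hα, hf.mono hv⟩)
  | box β =>
    have := β.rank_box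
    exact itp_box (ihA (boxInv Γ) (some β) (by simp only [rankO_some]; omega))
  | dia β =>
    have := β.rank_dia
    refine itp_dia (ihA (boxInv Γ) (some β) (by simp only [rankO_some]; omega)) ?_
    intro γ hγ
    have h₁ := γ.rank_dia
    have h₂ := rankM_erase hγ
    have h₃ := rankM_boxInv_le (Γ.erase γ.dia)
    rw [boxInv_erase_dia hγ] at h₃
    exact ihA _ _ (by simp only [rankM_cons, rankO_some]; omega)

end Step
/-! ### Uniformity -/

theorem cons_eq_add_cases {φ : Form} {Ξ Θ Γ : Multiset Form} (h : φ ::ₘ Ξ = Θ + Γ) :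
    (∃ Θ', Θ = φ ::ₘ Θ' ∧ Ξ = Θ' + Γ) ∨ (φ ∈ Γ ∧ Ξ = Θ + Γ.erase φ) := by
  have hm : φ ∈ Θ + Γ := h ▸ Multiset.mem_cons_self φ Ξ
  rcases Multiset.mem_add.1 hm with hm | hm
  · obtain ⟨Θ', rfl⟩ := Multiset.exists_cons_of_mem hm
    exact Or.inl ⟨Θ', rfl, by simpa using h⟩
  · obtain ⟨Γ', rfl⟩ := Multiset.exists_cons_of_mem hm
    exact Or.inr ⟨hm, by simpa using h⟩

theorem EU.intro {p : ℕ} {Γ : Multiset Form} {M : KModel} {P : M.W → Prop}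
    (hP : ∀ w v, M.le w v → P w → P v)
    (hL : ∀ w, P w → ∀ φ ∈ Γ, LeftE p (Γ.erase φ) φ M w)
    (hB : ∀ w, P w → ∀ u, M.R w u → EU p (boxInv Γ) M u) {w : M.W} (hw : P w) :
    EU p Γ M w := by
  have step_box : ∀ {Θ φ}, p ∉ varsM Θ → p ∉ vars φ → G4WK (boxInv (Θ + Γ)) (some φ) →
      ∀ w, P w → M.ForcesAll w Θ → M.Forces w φ.box := by
    intro Θ φ hp hφ hd w hw hf v hv u hu
    rw [boxInv_add] at hd
    exact hB v (hP w v hv hw) u hu _ (some φ) (fun h => hp (varsM_boxInv_subset Θ h)) hφ hd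
      ((hf.mono hv).boxInv hu)
  have step_dia : ∀ {Θ γ Δ}, p ∉ varsM Θ → p ∉ varsO Δ → Form.dia γ ∈ Θ + Γ →
      G4WK (γ ::ₘ boxInv (Θ + Γ)) (diaInv Δ) → ∀ w, P w → M.ForcesAll w Θ →
      M.ForcesOpt w Δ := by
    intro Θ γ Δ hp hΔ hm hd w hw hf
    have hp' : p ∉ varsM (boxInv Θ) := fun h => hp (varsM_boxInv_subset Θ h)
    have hΔ' : p ∉ varsO (diaInv Δ) := by
      unfold diaInv
      split
      · exact hΔ
      · simp [varsO]
    have key : ∀ v, M.le w v → ∃ u, M.R v u ∧ M.ForcesOpt u (diaInv Δ) := by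
      intro v hv
      rcases Multiset.mem_add.1 hm with hm | hm
      · obtain ⟨u, hu, hγ⟩ := hf _ hm v hv
        refine ⟨u, hu, hB v (hP w v hv hw) u hu (γ ::ₘ boxInv Θ) _ ?_ hΔ' (by simpa using hd)
          (forcesAll_cons.2 ⟨hγ, (hf.mono hv).boxInv hu⟩)⟩
        rw [varsM_cons]
        exact fun h => h.elim (fun h => hp ⟨_, hm, h⟩) hp'
      · obtain ⟨u, hu, hE⟩ := hL v (hP w v hv hw) _ hm
        rw [boxInv_erase_dia hm] at hE
        refine ⟨u, hu, hE (boxInv Θ) _ hp' hΔ' (by simpa using hd)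
          ((hf.mono hv).boxInv hu)⟩
    unfold diaInv at key
    split at key
    · exact key
    · obtain ⟨u, -, h⟩ := key w (M.le_refl w)
      exact h.elim
  intro Θ Δ hp hΔ hd hf
  generalize hΞ : Θ + Γ = Ξ at hd
  replace hΞ := hΞ.symm
  induction hd generalizing Θ w with
  | botL Ξ Δ =>
    rcases cons_eq_add_cases hΞ with ⟨Θ', rfl, -⟩ | ⟨hm, -⟩
    · exact (forcesAll_cons.1 hf).1.elim
    · exact (hL w hw _ hm).elim
  | idP Ξ n =>
    rcases cons_eq_add_cases hΞ with ⟨Θ', rfl, -⟩ | ⟨hm, -⟩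
    · exact (forcesAll_cons.1 hf).1
    · exact hL w hw _ hm fun h => hΔ h.symm
  | andL Ξ φ ψ Δ hd ih =>
    rcases cons_eq_add_cases hΞ with ⟨Θ', rfl, rfl⟩ | ⟨hm, rfl⟩
    · simp only [varsM_cons, vars, Set.mem_union, not_or] at hp
      have hf' := forcesAll_cons.1 hf
      refine ih hw (φ ::ₘ ψ ::ₘ Θ') ?_ hΔ ?_ (by simp)
      · simp [hp]
      · exact forcesAll_cons.2 ⟨hf'.1.1, forcesAll_cons.2 ⟨hf'.1.2, hf'.2⟩⟩
    · exact hL w hw _ hm Θ Δ hp hΔ (by simpa using hd) hf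
  | andR Ξ φ ψ _ _ ih₁ ih₂ =>
    simp only [varsO, vars, Set.mem_union, not_or] at hΔ
    exact ⟨ih₁ hw Θ hp hΔ.1 hf hΞ, ih₂ hw Θ hp hΔ.2 hf hΞ⟩
  | orL Ξ φ ψ Δ hd₁ hd₂ ih₁ ih₂ =>
    rcases cons_eq_add_cases hΞ with ⟨Θ', rfl, rfl⟩ | ⟨hm, rfl⟩
    · simp only [varsM_cons, vars, Set.mem_union, not_or] at hp
      rw [forcesAll_cons] at hf
      rcases hf.1 with h | h
      · exact ih₁ hw (φ ::ₘ Θ') (by simp [hp]) hΔ (forcesAll_cons.2 ⟨h, hf.2⟩) (by simp)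
      · exact ih₂ hw (ψ ::ₘ Θ') (by simp [hp]) hΔ (forcesAll_cons.2 ⟨h, hf.2⟩) (by simp)
    · rcases hL w hw _ hm with h | h
      · exact h Θ Δ hp hΔ (by simpa using hd₁) hf
      · exact h Θ Δ hp hΔ (by simpa using hd₂) hf
  | orR1 Ξ φ ψ _ ih =>
    simp only [varsO, vars, Set.mem_union, not_or] at hΔ
    exact Or.inl (ih hw Θ hp hΔ.1 hf hΞ)
  | orR2 Ξ φ ψ _ ih =>
    simp only [varsO, vars, Set.mem_union, not_or] at hΔ
    exact Or.inr (ih hw Θ hp hΔ.2 hf hΞ)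
  | impR Ξ φ ψ _ ih =>
    simp only [varsO, vars, Set.mem_union, not_or] at hΔ
    intro v hv hφ
    exact ih (hP w v hv hw) (φ ::ₘ Θ) (by simp [hp, hΔ]) hΔ.2
      (forcesAll_cons.2 ⟨hφ, hf.mono hv⟩) (by simp [hΞ])
  | andImpL Ξ φ ψ χ Δ hd ih =>
    rcases cons_eq_add_cases hΞ with ⟨Θ', rfl, rfl⟩ | ⟨hm, rfl⟩
    · simp only [varsM_cons, vars, Set.mem_union, not_or] at hp
      rw [forcesAll_cons] at hf
      refine ih hw (φ.imp (ψ.imp χ) ::ₘ Θ') (by simp [hp, vars]) hΔ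
        (forcesAll_cons.2 ⟨fun v hv hφ v' hv' hψ => ?_, hf.2⟩) (by simp)
      exact hf.1 v' (M.le_trans hv hv') ⟨hφ.mono hv', hψ⟩
    · exact hL w hw _ hm Θ Δ hp hΔ (by simpa using hd) hf
  | orImpL Ξ φ ψ χ Δ hd ih =>
    rcases cons_eq_add_cases hΞ with ⟨Θ', rfl, rfl⟩ | ⟨hm, rfl⟩
    · simp only [varsM_cons, vars, Set.mem_union, not_or] at hp
      rw [forcesAll_cons] at hf
      refine ih hw (φ.imp χ ::ₘ ψ.imp χ ::ₘ Θ') (by simp [hp, vars]) hΔ ?_ (by simp)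
      simp only [forcesAll_cons]
      exact ⟨fun v hv h => hf.1 v hv (Or.inl h), fun v hv h => hf.1 v hv (Or.inr h), hf.2⟩
    · exact hL w hw _ hm Θ Δ hp hΔ (by simpa using hd) hf
  | pImpL Ξ n φ Δ hd ih =>
    rw [Multiset.cons_swap] at hΞ
    rcases cons_eq_add_cases hΞ with ⟨Θ', rfl, h⟩ | ⟨hm, h⟩
    · simp only [varsM_cons, vars, Set.mem_union, not_or] at hp
      rw [forcesAll_cons] at hf
      have hn : M.V w n := by
        rcases cons_eq_add_cases h with ⟨Θ'', rfl, -⟩ | ⟨hm, -⟩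
        · exact (forcesAll_cons.1 hf.2).1
        · exact hL w hw _ hm fun h => hp.1.1 h.symm
      refine ih hw (φ ::ₘ Θ') (by simp [hp]) hΔ (forcesAll_cons.2 ⟨hf.1.mp hn, hf.2⟩) ?_
      rw [Multiset.cons_swap, h, Multiset.cons_add]
    · have hE := hL w hw _ hm
      refine hE ?_ Θ Δ hp hΔ ?_ hf
      · have hm' := h ▸ Multiset.mem_cons_self (Form.var n) Ξ
        rcases Multiset.mem_add.1 hm' with hm' | hm'
        · exact Or.inr ⟨fun e => hp ⟨_, hm', e.symm⟩, hf _ hm'⟩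
        · exact Or.inl hm'
      · rwa [Multiset.add_cons, ← h, Multiset.cons_swap]
  | impImpL Ξ φ ψ χ Δ hd₁ hd₂ ih₁ ih₂ =>
    rcases cons_eq_add_cases hΞ with ⟨Θ', rfl, rfl⟩ | ⟨hm, rfl⟩
    · simp only [varsM_cons, vars, Set.mem_union, not_or] at hp
      rw [forcesAll_cons] at hf
      have h : M.Forces w (φ.imp ψ) := by
        refine ih₁ hw (ψ.imp χ ::ₘ Θ') (by simp [hp, vars]) (by simp [varsO, hp, vars])
          (forcesAll_cons.2 ⟨fun v hv hψ => ?_, hf.2⟩) (by simp)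
        exact hf.1 v hv fun v' hv' _ => hψ.mono hv'
      exact ih₂ hw (χ ::ₘ Θ') (by simp [hp]) hΔ
        (forcesAll_cons.2 ⟨hf.1.mp h, hf.2⟩) (by simp)
    · exact hL w hw _ hm ⟨Θ, hp, hf, by simpa using hd₁⟩ Θ Δ hp hΔ (by simpa using hd₂) hf
  | boxR Ξ φ hd =>
    subst hΞ
    exact step_box (φ := φ) hp hΔ hd w hw hf
  | boxImpL Ξ φ ψ Δ hd₁ hd₂ _ ih₂ =>
    rcases cons_eq_add_cases hΞ with ⟨Θ', rfl, rfl⟩ | ⟨hm, rfl⟩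
    · simp only [varsM_cons, vars, Set.mem_union, not_or] at hp
      rw [forcesAll_cons] at hf
      exact ih₂ hw (ψ ::ₘ Θ') (by simp [hp]) hΔ (forcesAll_cons.2
        ⟨hf.1.mp (step_box hp.2 hp.1.1 hd₁ w hw hf.2), hf.2⟩) (by simp)
    · exact hL w hw _ hm ⟨Θ, hp, hf, by simpa using hd₁⟩ Θ Δ hp hΔ (by simpa using hd₂) hf
  | diaImpL Ξ γ φ ψ Δ hd₁ hd₂ _ ih₂ =>
    rcases cons_eq_add_cases hΞ with ⟨Θ', rfl, h⟩ | ⟨hm, h⟩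
    · simp only [varsM_cons, vars, Set.mem_union, not_or] at hp
      rw [forcesAll_cons] at hf
      have hφ : M.Forces w φ.dia := by
        refine step_dia (Δ := some φ.dia) hp.2 hp.1.1 (γ := γ) ?_ ?_ w hw hf.2
        · exact h ▸ Multiset.mem_cons_self _ _
        · rwa [← h, boxInv_cons_dia]
      refine ih₂ hw (ψ ::ₘ Θ') (by simp [hp]) hΔ
        (forcesAll_cons.2 ⟨hf.1.mp hφ, hf.2⟩) ?_
      rw [h, Multiset.cons_add]
    · refine hL w hw _ hm ⟨Θ, hp, hf, γ, ?_, ?_⟩ Θ Δ hp hΔ ?_ hf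
      · exact h ▸ Multiset.mem_cons_self _ _
      · rwa [← boxInv_add, ← h, boxInv_cons_dia]
      · rwa [Multiset.add_cons, ← h]
  | diaL' Ξ φ Δ hd =>
    refine step_dia hp hΔ (hΞ ▸ Multiset.mem_cons_self _ _) ?_ w hw hf
    rwa [← hΞ, boxInv_cons_dia]

theorem AU.elim {p : ℕ} {Γ : Multiset Form} {Δ : Option Form} {M : KModel} {w : M.W}
    {C : Prop} (hE : EU p Γ M w) (hL : ∀ φ ∈ Γ, LeftA p (Γ.erase φ) Δ φ M w → C)
    (hR : RightA p Γ Δ M w → C) (hA : AU p Γ Δ M w) : C := by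
  obtain ⟨Θ, hp, hf, hd⟩ := hA
  have hbot : ∀ Θ, p ∉ varsM Θ → M.ForcesAll w Θ → G4WK (Θ + Γ) (some .bot) → C :=
    fun Θ hp hf hd => (hE Θ (some .bot) hp (by simp [varsO, vars]) hd hf).elim
  generalize hΞ : Θ + Γ = Ξ at hd
  replace hΞ := hΞ.symm
  induction hd generalizing Θ with
  | botL Ξ Δ => exact hbot Θ hp hf (hΞ ▸ .botL Ξ _)
  | idP Ξ n =>
    have hm := hΞ ▸ Multiset.mem_cons_self (Form.var n) Ξ
    rcases Multiset.mem_add.1 hm with hm | hm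
    · exact hR (Or.inr ⟨fun e => hp ⟨_, hm, e.symm⟩, hf _ hm⟩)
    · exact hR (Or.inl hm)
  | andL Ξ φ ψ Δ hd ih =>
    rcases cons_eq_add_cases hΞ with ⟨Θ', rfl, rfl⟩ | ⟨hm, rfl⟩
    · simp only [varsM_cons, vars, Set.mem_union, not_or] at hp
      have hf' := forcesAll_cons.1 hf
      refine ih hL hR (φ ::ₘ ψ ::ₘ Θ') ?_ ?_ (by simp)
      · simp [hp]
      · exact forcesAll_cons.2 ⟨hf'.1.1, forcesAll_cons.2 ⟨hf'.1.2, hf'.2⟩⟩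
    · exact hL _ hm ⟨Θ, hp, hf, by simpa using hd⟩
  | andR Ξ φ ψ hd₁ hd₂ =>
    exact hR ⟨⟨Θ, hp, hf, hΞ ▸ hd₁⟩, ⟨Θ, hp, hf, hΞ ▸ hd₂⟩⟩
  | orL Ξ φ ψ Δ hd₁ hd₂ ih₁ ih₂ =>
    rcases cons_eq_add_cases hΞ with ⟨Θ', rfl, rfl⟩ | ⟨hm, rfl⟩
    · simp only [varsM_cons, vars, Set.mem_union, not_or] at hp
      rw [forcesAll_cons] at hf
      rcases hf.1 with h | h
      · exact ih₁ hL hR (φ ::ₘ Θ') (by simp [hp]) (forcesAll_cons.2 ⟨h, hf.2⟩) (by simp)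
      · exact ih₂ hL hR (ψ ::ₘ Θ') (by simp [hp]) (forcesAll_cons.2 ⟨h, hf.2⟩) (by simp)
    · exact hL _ hm ⟨⟨Θ, hp, hf, by simpa using hd₁⟩, ⟨Θ, hp, hf, by simpa using hd₂⟩⟩
  | orR1 Ξ φ ψ hd => exact hR (Or.inl ⟨Θ, hp, hf, hΞ ▸ hd⟩)
  | orR2 Ξ φ ψ hd => exact hR (Or.inr ⟨Θ, hp, hf, hΞ ▸ hd⟩)
  | impR Ξ φ ψ hd =>
    exact hR ⟨Θ, hp, hf, by rwa [Multiset.add_cons, ← hΞ]⟩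
  | andImpL Ξ φ ψ χ Δ hd ih =>
    rcases cons_eq_add_cases hΞ with ⟨Θ', rfl, rfl⟩ | ⟨hm, rfl⟩
    · simp only [varsM_cons, vars, Set.mem_union, not_or] at hp
      rw [forcesAll_cons] at hf
      refine ih hL hR (φ.imp (ψ.imp χ) ::ₘ Θ') (by simp [hp, vars])
        (forcesAll_cons.2 ⟨fun v hv hφ v' hv' hψ => ?_, hf.2⟩) (by simp)
      exact hf.1 v' (M.le_trans hv hv') ⟨hφ.mono hv', hψ⟩
    · exact hL _ hm ⟨Θ, hp, hf, by simpa using hd⟩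
  | orImpL Ξ φ ψ χ Δ hd ih =>
    rcases cons_eq_add_cases hΞ with ⟨Θ', rfl, rfl⟩ | ⟨hm, rfl⟩
    · simp only [varsM_cons, vars, Set.mem_union, not_or] at hp
      rw [forcesAll_cons] at hf
      refine ih hL hR (φ.imp χ ::ₘ ψ.imp χ ::ₘ Θ') (by simp [hp, vars]) ?_ (by simp)
      simp only [forcesAll_cons]
      exact ⟨fun v hv h => hf.1 v hv (Or.inl h), fun v hv h => hf.1 v hv (Or.inr h), hf.2⟩
    · exact hL _ hm ⟨Θ, hp, hf, by simpa using hd⟩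
  | pImpL Ξ n φ Δ hd ih =>
    rw [Multiset.cons_swap] at hΞ
    rcases cons_eq_add_cases hΞ with ⟨Θ', rfl, h⟩ | ⟨hm, h⟩
    · simp only [varsM_cons, vars, Set.mem_union, not_or] at hp
      rw [forcesAll_cons] at hf
      have hn : M.Forces w (.var n) := hE Θ' (some (.var n)) hp.2 hp.1.1 (h ▸ .idP Ξ n) hf.2
      refine ih hL hR (φ ::ₘ Θ') (by simp [hp]) (forcesAll_cons.2 ⟨hf.1.mp hn, hf.2⟩) ?_
      rw [Multiset.cons_swap, h, Multiset.cons_add]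
    · refine hL _ hm ⟨?_, Θ, hp, hf, ?_⟩
      · have hm' := h ▸ Multiset.mem_cons_self (Form.var n) Ξ
        rcases Multiset.mem_add.1 hm' with hm' | hm'
        · exact Or.inr ⟨fun e => hp ⟨_, hm', e.symm⟩, hf _ hm'⟩
        · exact Or.inl hm'
      · rwa [Multiset.add_cons, ← h, Multiset.cons_swap]
  | impImpL Ξ φ ψ χ Δ hd₁ hd₂ _ ih₂ =>
    rcases cons_eq_add_cases hΞ with ⟨Θ', rfl, rfl⟩ | ⟨hm, rfl⟩
    · simp only [varsM_cons, vars, Set.mem_union, not_or] at hp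
      rw [forcesAll_cons] at hf
      have h : M.Forces w (φ.imp ψ) := by
        refine hE (ψ.imp χ ::ₘ Θ') (some (φ.imp ψ)) (by simp [hp, vars])
          (by simp [varsO, hp, vars]) (by simpa using hd₁)
          (forcesAll_cons.2 ⟨fun v hv hψ => ?_, hf.2⟩)
        exact hf.1 v hv fun v' hv' _ => hψ.mono hv'
      exact ih₂ hL hR (χ ::ₘ Θ') (by simp [hp])
        (forcesAll_cons.2 ⟨hf.1.mp h, hf.2⟩) (by simp)
    · exact hL _ hm ⟨⟨Θ, hp, hf, by simpa using hd₁⟩, ⟨Θ, hp, hf, by simpa using hd₂⟩⟩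
  | boxR Ξ φ hd =>
    subst hΞ
    exact hR ⟨Θ, hp, hf, by rwa [← boxInv_add]⟩
  | boxImpL Ξ φ ψ Δ hd₁ hd₂ _ ih₂ =>
    rcases cons_eq_add_cases hΞ with ⟨Θ', rfl, rfl⟩ | ⟨hm, rfl⟩
    · simp only [varsM_cons, vars, Set.mem_union, not_or] at hp
      rw [forcesAll_cons] at hf
      have h : M.Forces w φ.box := hE Θ' (some φ.box) hp.2 hp.1.1 (.boxR _ _ hd₁) hf.2
      exact ih₂ hL hR (ψ ::ₘ Θ') (by simp [hp])
        (forcesAll_cons.2 ⟨hf.1.mp h, hf.2⟩) (by simp)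
    · exact hL _ hm ⟨⟨Θ, hp, hf, by simpa using hd₁⟩, ⟨Θ, hp, hf, by simpa using hd₂⟩⟩
  | diaImpL Ξ γ φ ψ Δ hd₁ hd₂ _ ih₂ =>
    rcases cons_eq_add_cases hΞ with ⟨Θ', rfl, h⟩ | ⟨hm, h⟩
    · simp only [varsM_cons, vars, Set.mem_union, not_or] at hp
      rw [forcesAll_cons] at hf
      have hφ : M.Forces w φ.dia :=
        hE Θ' (some φ.dia) hp.2 hp.1.1 (h ▸ .diaL' Ξ γ (some φ.dia) hd₁) hf.2
      refine ih₂ hL hR (ψ ::ₘ Θ') (by simp [hp])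
        (forcesAll_cons.2 ⟨hf.1.mp hφ, hf.2⟩) ?_
      rw [h, Multiset.cons_add]
    · refine hL _ hm ⟨⟨Θ, hp, hf, γ, ?_, ?_⟩, Θ, hp, hf, ?_⟩
      · exact h ▸ Multiset.mem_cons_self _ _
      · rwa [← boxInv_add, ← h, boxInv_cons_dia]
      · rwa [Multiset.add_cons, ← h]
  | diaL' Ξ γ Δ hd =>
    by_cases hδ : ∃ δ, Δ = some (Form.dia δ)
    · obtain ⟨δ, rfl⟩ := hδ
      refine hR ⟨Θ, hp, hf, γ, hΞ ▸ Multiset.mem_cons_self _ _, ?_⟩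
      rwa [← boxInv_add, ← hΞ, boxInv_cons_dia]
    · have hn : diaInv Δ = none := by
        unfold diaInv
        split
        · exact (hδ ⟨_, rfl⟩).elim
        · rfl
      rw [hn] at hd
      exact hbot Θ hp hf (hΞ ▸ .diaL' Ξ γ (some .bot) hd)

/-! ### The interpolants -/

theorem hasE_step {p : ℕ} {Γ : Multiset Form} (ihE : ∀ Γ', rankM Γ' < rankM Γ → HasE p Γ')
    (ihA : ∀ Γ' Δ', rankM Γ' + rankO Δ' < rankM Γ → HasA p Γ' Δ') : HasE p Γ := by
  rcases Γ.empty_or_exists_mem with rfl | ⟨ψ, hψ⟩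
  · refine Itp.top fun M w Θ Δ _ _ hd hf => ?_
    rw [add_zero] at hd
    exact hd.sound M w hf
  have hL : ∀ φ ∈ Γ, Itp (varsM Γ \ {p}) (fun M w => M.ForcesAll w Γ)
      (LeftE p (Γ.erase φ) φ) := by
    intro φ hφ
    have := itp_leftE (p := p) (φ := φ) (Γ := Γ.erase φ)
    rw [Multiset.cons_erase hφ] at this
    exact this ihE ihA
  obtain ⟨e, he, h₁, h₂⟩ := (Itp.forallMem hL).and
    ((Itp.box (ihE _ (rankM_boxInv_lt hψ))).mono
      (Set.sdiff_subset_sdiff_left (varsM_boxInv_subset Γ)) (fun _ _ h => h) (fun _ _ h => h))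
  refine ⟨e, he, fun M w hf => h₁ M w ⟨fun _ _ => hf, fun v hv u hu => ?_⟩,
    fun M w hw => EU.intro (P := fun w => M.Forces w e) (fun w v hv h => h.mono hv)
      (fun w hw => (h₂ M w hw).1) (fun w hw => (h₂ M w hw).2 w (M.le_refl w)) hw⟩
  exact (hf.mono hv).boxInv hu

theorem hasA_step {p : ℕ} {Γ : Multiset Form} {Δ : Option Form} (hE : HasE p Γ)
    (ihA : ∀ Γ' Δ', rankM Γ' + rankO Δ' < rankM Γ + rankO Δ → HasA p Γ' Δ') :
    HasA p Γ Δ := by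
  have hL : ∀ φ ∈ Γ, Itp ((varsM Γ ∪ varsO Δ) \ {p}) (LeftA p (Γ.erase φ) Δ φ)
      (fun M w => M.ForcesAll w Γ → M.ForcesOpt w Δ) := by
    intro φ hφ
    have := itp_leftA (p := p) (φ := φ) (Γ := Γ.erase φ) (Δ := Δ)
    rw [Multiset.cons_erase hφ] at this
    exact this ihA
  refine (Itp.imp (hE.mono (Set.sdiff_subset_sdiff_left Set.subset_union_left)
    (fun _ _ h => h) (fun _ _ h => h)) ((Itp.existsMem hL).or (itp_rightA ihA))).mono
    subset_rfl ?_ ?_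
  · rintro M w ⟨Θ, hp, hf, hd⟩ v hv hEv
    exact AU.elim hEv (fun φ hφ h => Or.inl ⟨φ, hφ, h⟩) Or.inr ⟨Θ, hp, hf.mono hv, hd⟩
  · intro M w h hf
    rcases h w (M.le_refl w) hf with ⟨φ, hφ, h⟩ | h <;> exact h hf

theorem hasE_and_hasA (p n : ℕ) :
    (∀ Γ, rankM Γ = n → HasE p Γ) ∧ ∀ Γ Δ, rankM Γ + rankO Δ = n → HasA p Γ Δ := by
  induction n using Nat.strong_induction_on with
  | _ n ih =>
    have hE : ∀ Γ, rankM Γ = n → HasE p Γ := fun Γ h =>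
      hasE_step (fun Γ' h' => (ih _ (h ▸ h')).1 Γ' rfl)
        (fun Γ' Δ' h' => (ih _ (h ▸ h')).2 Γ' Δ' rfl)
    refine ⟨hE, fun Γ Δ h => hasA_step ?_ fun Γ' Δ' h' => (ih _ (h ▸ h')).2 Γ' Δ' rfl⟩
    rcases Nat.lt_or_ge (rankM Γ) n with h' | h'
    · exact (ih _ h').1 Γ rfl
    · exact hE Γ (by omega)

theorem hasE (p : ℕ) (Γ : Multiset Form) : HasE p Γ := (hasE_and_hasA p _).1 Γ rfl

theorem hasA (p : ℕ) (Γ : Multiset Form) (Δ : Option Form) : HasA p Γ Δ :=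
  (hasE_and_hasA p _).2 Γ Δ rfl

/-- The sequent calculus G4WK has the uniform interpolation property:
there are formulas `E p Γ` and `A p Γ Δ` satisfying p-freeness,
implication and uniformity. -/
theorem G4WK_uniform_interpolation :
    ∃ (E : ℕ → Multiset Form → Form) (A : ℕ → Multiset Form → Option Form → Form),
      ∀ (p : ℕ) (Γ : Multiset Form) (Δ : Option Form),
        -- (1) p-freeness
        vars (E p Γ) ⊆ varsM Γ \ {p} ∧
        vars (A p Γ Δ) ⊆ (varsM Γ ∪ varsO Δ) \ {p} ∧
        -- (2) implication
        G4WK Γ (some (E p Γ)) ∧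
        G4WK (A p Γ Δ ::ₘ Γ) Δ ∧
        -- (3) uniformity
        (∀ Θ : Multiset Form, p ∉ varsM Θ → G4WK (Θ + Γ) Δ →
          (p ∉ varsO Δ → G4WK (E p Γ ::ₘ Θ) Δ) ∧
          G4WK (E p Γ ::ₘ Θ) (some (A p Γ Δ))) := by
  choose E hE₁ hE₂ hE₃ using hasE
  choose A hA₁ hA₂ hA₃ using hasA
  refine ⟨E, A, fun p Γ Δ => ⟨hE₁ p Γ, hA₁ p Γ Δ, G4WK.complete _ _ fun M w => hE₂ p Γ M w,
    G4WK.complete _ _ fun M w h => ?_, fun Θ hp hd => ⟨fun hΔ => ?_, ?_⟩⟩⟩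
  · rw [forcesAll_cons] at h
    exact hA₃ p Γ Δ M w h.1 h.2
  · refine G4WK.complete _ _ fun M w h => ?_
    rw [forcesAll_cons] at h
    exact hE₃ p Γ M w h.1 Θ Δ hp hΔ hd h.2
  · refine G4WK.complete _ _ fun M w h => ?_
    rw [forcesAll_cons] at h
    exact hA₂ p Γ Δ M w ⟨Θ, hp, h.2, hd⟩
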